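/- arXiv:0806.3590 — 2 statements merged into one kernel-verified Lean document; each statement's English description precedes it below -/
import Mathlib

section
/- For every real x > 0, with q = e^{−πx/√8}, one has F_{(2,2)}(x) = (9π²/(32√2·x)) · ∫_0^q φ(−u²)·φ(u⁴)·( 3ψ(−u²)⁴ − ψ(u²)⁴ ) du, where the integral is over the real interval [0,q]. -/
open Real Filter Topology

/-- The two-dimensional lattice sum `F_{(2,2)}(x)`. -/
noncomputable def F22 (x : ℝ) : ℝ :=
  9 * ∑' p : ℕ × ℕ, (-1:ℝ)^(p.1*(p.1+1)/2 + p.2) * (2*(p.2:ℝ)+1) /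
    (2*(2*(p.2:ℝ)+1)^2 + x^2*(2*(p.1:ℝ)+1)^2)^2

/-- Ramanujan's theta function `φ(q) = Σ_{n∈ℤ} q^{n²}` (real argument). -/
noncomputable def phiR (q : ℝ) : ℝ := ∑' n : ℤ, q^(n^2)

/-- Ramanujan's theta function `ψ(q) = Σ_{n≥0} q^{n(n+1)/2}` (real argument). -/
noncomputable def psiR (q : ℝ) : ℝ := ∑' n : ℕ, q^(n*(n+1)/2)

/-! ### Summability of theta-like series -/

theorem summable_int_poly_geometric {r : ℝ} (h0 : 0 ≤ r) (h1 : r < 1) (k : ℕ) :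
    Summable fun n : ℤ => ((n.natAbs : ℝ) + 1) ^ k * r ^ n.natAbs := by
  have key : Summable fun n : ℕ => ((n : ℝ) + 1) ^ k * r ^ n := by
    rcases h0.eq_or_lt with rfl | h0
    · refine summable_of_ne_finset_zero (s := {0}) fun n hn => ?_
      simp at hn
      simp [hn]
    have h := (summable_pow_mul_geometric_of_norm_lt_one (R := ℝ) k (r := r)
      (by rwa [Real.norm_eq_abs, abs_of_pos h0]))
    have h2 := ((summable_nat_add_iff 1).mpr h).mul_left r⁻¹
    refine h2.congr fun n => ?_
    push_cast
    rw [pow_succ]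
    field_simp
  refine Summable.of_nat_of_neg ?_ ?_
  · simpa using key
  · simpa using key

theorem summable_mul_zpow {c : ℤ → ℝ} {e : ℤ → ℤ} {q : ℝ} (hq0 : q ≠ 0) (hq : |q| < 1) (k : ℕ)
    (C : ℝ) (hc : ∀ n, |c n| ≤ C * ((n.natAbs : ℝ) + 1) ^ k)
    (he : ∀ n, (n.natAbs : ℤ) - 1 ≤ e n) : Summable fun n => c n * q ^ e n := by
  have hpos : 0 < |q| := abs_pos.mpr hq0
  refine Summable.of_norm_bounded
    (((summable_int_poly_geometric hpos.le hq k).mul_left (C * |q|⁻¹))) fun n => ?_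
  rw [norm_mul, norm_zpow, Real.norm_eq_abs, Real.norm_eq_abs]
  have h1 : |q| ^ e n ≤ |q| ^ ((n.natAbs : ℤ) - 1) :=
    zpow_le_zpow_right_of_le_one₀ hpos hq.le (he n)
  have h2 : |q| ^ ((n.natAbs : ℤ) - 1) = |q|⁻¹ * |q| ^ n.natAbs := by
    rw [zpow_sub_one₀ hpos.ne', zpow_natCast, mul_comm]
  calc |c n| * |q| ^ e n ≤ (C * ((n.natAbs : ℝ) + 1) ^ k) * (|q|⁻¹ * |q| ^ n.natAbs) := by
        rw [← h2]
        exact mul_le_mul (hc n) h1 (by positivity) ((abs_nonneg _).trans (hc n))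
    _ = _ := by ring

theorem natAbs_sub_one_le_sq (n : ℤ) : (n.natAbs : ℤ) - 1 ≤ n ^ 2 := by
  rw [Int.natCast_natAbs, ← sq_abs]
  nlinarith [abs_nonneg n]

theorem natAbs_sub_one_le_of_two_mul {n m : ℤ} (h : 2 * m = n * (n + 1)) :
    (n.natAbs : ℤ) - 1 ≤ m := by
  rcases le_total 0 n with hn | hn
  · have : (n.natAbs : ℤ) = n := by omega
    rw [this]; nlinarith [sq_nonneg (n - 1)]
  · have : (n.natAbs : ℤ) = -n := by omega
    rw [this]
    rcases (show n = 0 ∨ n = -1 ∨ n = -2 ∨ n ≤ -3 by omega) with rfl | rfl | rfl | h3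
    · omega
    · omega
    · omega
    · nlinarith

/-! ### Splitting double sums by parity -/

/-- Pairs of integers, split according to whether their sum is even or odd. -/
def parityEquiv : (ℤ × ℤ) ⊕ (ℤ × ℤ) ≃ ℤ × ℤ where
  toFun := Sum.elim (fun p => (p.1 + p.2, p.1 - p.2)) (fun p => (p.1 + p.2 + 1, p.1 - p.2))
  invFun p := if (p.1 + p.2) % 2 = 0 then Sum.inl ((p.1 + p.2) / 2, (p.1 - p.2) / 2)
    else Sum.inr ((p.1 + p.2 - 1) / 2, (p.1 - p.2 - 1) / 2)
  left_inv := by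
    rintro (⟨a, b⟩ | ⟨a, b⟩)
    · have h : (a + b + (a - b)) % 2 = 0 := by omega
      simp only [Sum.elim_inl, h, if_true, Sum.inl.injEq, Prod.mk.injEq]
      omega
    · have h : ¬ (a + b + 1 + (a - b)) % 2 = 0 := by omega
      simp only [Sum.elim_inr, h, if_false, Sum.inr.injEq, Prod.mk.injEq]
      omega
  right_inv := by
    rintro ⟨m, n⟩
    by_cases h : (m + n) % 2 = 0
    · simp only [h, if_true, Sum.elim_inl, Prod.mk.injEq]
      omega
    · simp only [h, if_false, Sum.elim_inr, Prod.mk.injEq]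
      omega

theorem tsum_mul_tsum_parity {f g : ℤ → ℝ} (hf : Summable f) (hg : Summable g) :
    (∑' n, f n) * (∑' n, g n) = ∑' p : ℤ × ℤ, f (p.1 + p.2) * g (p.1 - p.2) +
      ∑' p : ℤ × ℤ, f (p.1 + p.2 + 1) * g (p.1 - p.2) := by
  rw [tsum_mul_tsum_of_summable_norm hf.norm hg.norm]
  have hs := summable_mul_of_summable_norm hf.norm hg.norm
  rw [← parityEquiv.tsum_eq]
  have hs' := (parityEquiv.summable_iff).mpr hs
  rw [Summable.tsum_sum]
  · rfl
  · exact hs'.comp_injective Sum.inl_injective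
  · exact hs'.comp_injective Sum.inr_injective

theorem tsum_prod_mul_of_eq {F : ℤ × ℤ → ℝ} {f g : ℤ → ℝ} (hf : Summable f) (hg : Summable g)
    (h : ∀ a b, F (a, b) = f a * g b) : ∑' p, F p = (∑' n, f n) * (∑' n, g n) := by
  rw [tsum_mul_tsum_of_summable_norm hf.norm hg.norm]
  exact tsum_congr fun p => h p.1 p.2

theorem tsum_int_eq_zero_of_involution {f : ℤ → ℝ} (c : ℤ) (h : ∀ n, f (c - n) = - f n) :
    ∑' n, f n = 0 := by
  have h1 : ∑' n, f (c - n) = ∑' n, f n := (Equiv.subLeft c).tsum_eq f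
  simp_rw [h, tsum_neg] at h1
  linarith

/-! ### Theta functions as bilateral series -/

/-- Triangular numbers with integer index. -/
def tri (n : ℤ) : ℤ := n * (n + 1) / 2

theorem two_mul_tri (n : ℤ) : 2 * tri n = n * (n + 1) :=
  Int.mul_ediv_cancel' (Int.even_mul_succ_self n).two_dvd

theorem natAbs_sub_one_le_tri (n : ℤ) : (n.natAbs : ℤ) - 1 ≤ tri n :=
  natAbs_sub_one_le_of_two_mul (two_mul_tri n)

theorem tri_natCast (n : ℕ) : tri n = ((n * (n + 1) / 2 : ℕ) : ℤ) := by
  simp [tri]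

theorem tri_neg_succ (n : ℤ) : tri (-(n + 1)) = tri n := by
  simp only [tri]; ring_nf

theorem tri_neg_one_sub (n : ℤ) : tri (-1 - n) = tri n := by
  simp only [tri]; ring_nf

section

variable {q : ℝ}

theorem summable_sq (h0 : q ≠ 0) (h1 : |q| < 1) : Summable fun n : ℤ => q ^ (n ^ 2) := by
  simpa using summable_mul_zpow (c := fun _ => 1) h0 h1 0 1 (by simp) natAbs_sub_one_le_sq

theorem summable_tri (h0 : q ≠ 0) (h1 : |q| < 1) : Summable fun n : ℤ => q ^ tri n := by
  simpa using summable_mul_zpow (c := fun _ => 1) h0 h1 0 1 (by simp) natAbs_sub_one_le_tri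

theorem abs_negOnePow (n : ℤ) : |(-1 : ℝ) ^ n| = 1 := by
  rw [abs_zpow]; simp

theorem summable_alt_sq (h0 : q ≠ 0) (h1 : |q| < 1) :
    Summable fun n : ℤ => (-1 : ℝ) ^ n * q ^ (n ^ 2) :=
  summable_mul_zpow h0 h1 0 1 (by simp) natAbs_sub_one_le_sq

theorem tsum_tri (h0 : q ≠ 0) (h1 : |q| < 1) : ∑' n : ℤ, q ^ tri n = 2 * psiR q := by
  have hs1 : Summable fun n : ℕ => q ^ tri (n : ℤ) :=
    (summable_tri h0 h1).comp_injective (i := fun n : ℕ => (n : ℤ)) Nat.cast_injective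
  have hs2 : Summable fun n : ℕ => q ^ tri (-((n : ℤ) + 1)) :=
    hs1.congr fun n => by rw [tri_neg_succ]
  have e1 : ∑' n : ℕ, q ^ tri (n : ℤ) = psiR q :=
    tsum_congr fun n => by rw [tri_natCast, zpow_natCast]
  have e2 : ∑' n : ℕ, q ^ tri (-((n : ℤ) + 1)) = psiR q := by
    rw [← e1]
    exact tsum_congr fun n => by rw [tri_neg_succ]
  have h := (HasSum.of_nat_of_neg_add_one (f := fun n : ℤ => q ^ tri n)
    hs1.hasSum hs2.hasSum).tsum_eq
  rw [h, e1, e2]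
  ring

theorem neg_one_zpow_sq (n : ℤ) : (-1 : ℝ) ^ (n ^ 2) = (-1) ^ n := by
  rcases Int.even_or_odd n with h | h
  · rw [h.neg_one_zpow, (h.pow_of_ne_zero two_ne_zero).neg_one_zpow]
  · rw [h.neg_one_zpow, (h.pow).neg_one_zpow]

theorem phiR_neg (q : ℝ) : phiR (-q) = ∑' n : ℤ, (-1 : ℝ) ^ n * q ^ (n ^ 2) := by
  refine tsum_congr fun n => ?_
  rw [neg_eq_neg_one_mul, mul_zpow, neg_one_zpow_sq]

theorem tri_add_add_tri_sub (a b : ℤ) : tri (a + b) + tri (a - b) = 2 * tri a + b ^ 2 := by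
  have h1 := two_mul_tri (a + b)
  have h2 := two_mul_tri (a - b)
  have h3 := two_mul_tri a
  nlinarith

theorem tri_add_succ_add_tri_sub (a b : ℤ) :
    tri (a + b + 1) + tri (a - b) = (a + 1) ^ 2 + 2 * tri b := by
  have h1 := two_mul_tri (a + b + 1)
  have h2 := two_mul_tri (a - b)
  have h3 := two_mul_tri b
  nlinarith

theorem abs_sq_lt_one (h1 : |q| < 1) : |q ^ 2| < 1 := by
  rw [abs_pow]; exact pow_lt_one₀ (abs_nonneg q) h1 two_ne_zero

theorem pow_zpow_two (q : ℝ) (n : ℤ) : (q ^ 2) ^ n = q ^ (2 * n) := by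
  rw [zpow_mul]; norm_cast

theorem phiR_sq (h0 : q ≠ 0) (h1 : |q| < 1) :
    phiR q ^ 2 = phiR (q ^ 2) ^ 2 + 4 * q * psiR (q ^ 4) ^ 2 := by
  have hs := summable_sq h0 h1
  have hs2 := summable_sq (pow_ne_zero 2 h0) (abs_sq_lt_one h1)
  have h4 : |q ^ 4| < 1 := by
    rw [abs_pow]; exact pow_lt_one₀ (abs_nonneg q) h1 (by norm_num)
  have ht4 := summable_tri (pow_ne_zero 4 h0) h4
  have e4 : ∀ n : ℤ, (q ^ 4) ^ n = q ^ (4 * n) := fun n => by rw [zpow_mul]; norm_cast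
  rw [sq, phiR, tsum_mul_tsum_parity hs hs, tsum_prod_mul_of_eq hs2 hs2,
    tsum_prod_mul_of_eq (ht4.mul_left q) ht4, tsum_mul_left, tsum_tri (pow_ne_zero 4 h0) h4, phiR]
  · ring
  · intro a b
    rw [e4, e4, mul_assoc, ← zpow_add₀ h0, ← zpow_add₀ h0, ← zpow_one_add₀ h0]
    congr 1
    have := two_mul_tri a
    have := two_mul_tri b
    ring_nf at *
    linarith
  · intro a b
    rw [pow_zpow_two, pow_zpow_two, ← zpow_add₀ h0, ← zpow_add₀ h0]
    ring_nf

theorem phiR_mul_phiR_neg (h0 : q ≠ 0) (h1 : |q| < 1) :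
    phiR q * phiR (-q) = phiR (-q ^ 2) ^ 2 := by
  have hs := summable_sq h0 h1
  have ha := summable_alt_sq h0 h1
  have ha2 := summable_alt_sq (pow_ne_zero 2 h0) (abs_sq_lt_one h1)
  have h4 : |q ^ 4| < 1 := by
    rw [abs_pow]; exact pow_lt_one₀ (abs_nonneg q) h1 (by norm_num)
  have ht4 : Summable fun n : ℤ => (-1 : ℝ) ^ n * (q ^ 4) ^ tri n :=
    summable_mul_zpow (pow_ne_zero 4 h0) h4 0 1 (by simp) natAbs_sub_one_le_tri
  have e4 : ∀ n : ℤ, (q ^ 4) ^ n = q ^ (4 * n) := fun n => by rw [zpow_mul]; norm_cast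
  have hz : ∑' n : ℤ, (-1 : ℝ) ^ n * (q ^ 4) ^ tri n = 0 := by
    refine tsum_int_eq_zero_of_involution (-1) fun n => ?_
    rw [tri_neg_one_sub, show (-1 - n : ℤ) = -(n + 1) by ring, zpow_neg, zpow_add_one₀ (by simp),
      mul_inv, ← zpow_neg]
    have : (-1 : ℝ) ^ (-n) = (-1) ^ n := by rw [zpow_neg, ← inv_zpow]; norm_num
    rw [this]; norm_num
  have sgn : ∀ a b : ℤ, (-1 : ℝ) ^ (a - b) = (-1) ^ a * (-1) ^ b := fun a b => by
    rw [zpow_sub₀ (by norm_num), div_eq_mul_inv, ← inv_zpow]; norm_num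
  rw [phiR_neg, phiR, tsum_mul_tsum_parity hs ha, tsum_prod_mul_of_eq ha2 ha2,
    tsum_prod_mul_of_eq (ht4.mul_left q) ht4, tsum_mul_left, hz, phiR_neg]
  · ring
  · intro a b
    rw [e4, e4, sgn, show q ^ (a + b + 1) ^ 2 * ((-1) ^ a * (-1) ^ b * q ^ (a - b) ^ 2) =
      (-1) ^ a * (-1) ^ b * (q ^ (a + b + 1) ^ 2 * q ^ (a - b) ^ 2) by ring,
      show q * ((-1) ^ a * q ^ (4 * tri a)) * ((-1) ^ b * q ^ (4 * tri b)) =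
      (-1) ^ a * (-1) ^ b * (q * (q ^ (4 * tri a) * q ^ (4 * tri b))) by ring,
      ← zpow_add₀ h0, ← zpow_add₀ h0, ← zpow_one_add₀ h0]
    congr 2
    have := two_mul_tri a
    have := two_mul_tri b
    ring_nf at *
    linarith
  · intro a b
    rw [pow_zpow_two, pow_zpow_two, sgn, show q ^ (a + b) ^ 2 * ((-1) ^ a * (-1) ^ b * q ^ (a - b) ^ 2)
      = (-1) ^ a * (-1) ^ b * (q ^ (a + b) ^ 2 * q ^ (a - b) ^ 2) by ring,
      show (-1) ^ a * q ^ (2 * a ^ 2) * ((-1) ^ b * q ^ (2 * b ^ 2)) =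
      (-1) ^ a * (-1) ^ b * (q ^ (2 * a ^ 2) * q ^ (2 * b ^ 2)) by ring,
      ← zpow_add₀ h0, ← zpow_add₀ h0]
    ring_nf

theorem tsum_succ_int (f : ℤ → ℝ) : ∑' n, f (n + 1) = ∑' n, f n :=
  (Equiv.addRight (1 : ℤ)).tsum_eq f

theorem Summable.succ_int {f : ℤ → ℝ} (hf : Summable f) : Summable fun n => f (n + 1) :=
  (Equiv.addRight (1 : ℤ)).summable_iff.mpr hf

theorem psiR_sq (h0 : q ≠ 0) (h1 : |q| < 1) : psiR q ^ 2 = psiR (q ^ 2) * phiR q := by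
  have h2 := pow_ne_zero 2 h0
  have h21 := abs_sq_lt_one h1
  have hs := summable_sq h0 h1
  have ht := summable_tri h0 h1
  have ht2 := summable_tri h2 h21
  have key : (∑' n : ℤ, q ^ tri n) * (∑' n : ℤ, q ^ tri n) = 2 * (2 * psiR (q ^ 2) * phiR q) := by
    rw [tsum_mul_tsum_parity ht ht, tsum_prod_mul_of_eq ht2 hs,
      tsum_prod_mul_of_eq hs.succ_int ht2, tsum_succ_int (fun n => q ^ n ^ 2), tsum_tri h2 h21, phiR]
    · ring
    · intro a b
      rw [pow_zpow_two, ← zpow_add₀ h0, ← zpow_add₀ h0, tri_add_succ_add_tri_sub]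
    · intro a b
      rw [pow_zpow_two, ← zpow_add₀ h0, ← zpow_add₀ h0, tri_add_add_tri_sub]
  rw [tsum_tri h0 h1] at key
  linarith

/-- Jacobi's series `Σ_{n ≥ 0} (-1)ⁿ (2n+1) q^{n(n+1)/2}` for the cube of the eta function,
doubled to a sum over all integers. -/
noncomputable def etaCube (q : ℝ) : ℝ := ∑' n : ℤ, (-1 : ℝ) ^ n * (2 * n + 1) * q ^ tri n

theorem abs_alt_odd_le (n : ℤ) : |(-1 : ℝ) ^ n * (2 * n + 1)| ≤ 2 * ((n.natAbs : ℝ) + 1) ^ 1 := by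
  rw [abs_mul, abs_negOnePow, one_mul, pow_one, Nat.cast_natAbs, Int.cast_abs]
  calc |(2 * n + 1 : ℝ)| ≤ |(2 * n : ℝ)| + |1| := abs_add_le _ _
    _ ≤ _ := by rw [abs_mul]; norm_num; linarith

theorem summable_etaCube (h0 : q ≠ 0) (h1 : |q| < 1) :
    Summable fun n : ℤ => (-1 : ℝ) ^ n * (2 * n + 1) * q ^ tri n :=
  summable_mul_zpow h0 h1 1 2 abs_alt_odd_le natAbs_sub_one_le_tri

theorem summable_alt_mul_sq (h0 : q ≠ 0) (h1 : |q| < 1) :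
    Summable fun n : ℤ => (-1 : ℝ) ^ n * n * q ^ (n ^ 2) := by
  refine summable_mul_zpow h0 h1 1 1 (fun n => ?_) natAbs_sub_one_le_sq
  rw [abs_mul, abs_negOnePow, one_mul, pow_one, Nat.cast_natAbs, Int.cast_abs]
  linarith

theorem neg_one_zpow_neg (n : ℤ) : (-1 : ℝ) ^ (-n) = (-1) ^ n := by
  rw [zpow_neg, ← inv_zpow]; norm_num

theorem etaCube_mul_psiR (h0 : q ≠ 0) (h1 : |q| < 1) :
    etaCube q * psiR q = etaCube (q ^ 2) * phiR (-q) := by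
  have h2 := pow_ne_zero 2 h0
  have h21 := abs_sq_lt_one h1
  have ht := summable_tri h0 h1
  have hj := summable_etaCube h0 h1
  have hj2 := summable_etaCube h2 h21
  have hs := summable_alt_sq h0 h1
  have hn := summable_alt_mul_sq h0 h1
  have hat2 : Summable fun n : ℤ => (-1 : ℝ) ^ n * (q ^ 2) ^ tri n :=
    summable_mul_zpow h2 h21 0 1 (by simp) natAbs_sub_one_le_tri
  have hz : ∑' n : ℤ, (-1 : ℝ) ^ n * n * q ^ (n ^ 2) = 0 := by
    refine tsum_int_eq_zero_of_involution 0 fun n => ?_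
    rw [zero_sub, neg_one_zpow_neg]
    push_cast
    ring_nf
  have p1 := summable_mul_of_summable_norm hj2.norm hs.norm
  have p2 := summable_mul_of_summable_norm hat2.norm (hn.mul_left 2).norm
  have p3 := summable_mul_of_summable_norm hs.succ_int.norm hj2.norm
  have p4 := summable_mul_of_summable_norm (hn.mul_left 2).succ_int.norm hat2.norm
  have key : etaCube q * (∑' n : ℤ, q ^ tri n) = 2 * (etaCube (q ^ 2) * phiR (-q)) := by
    rw [etaCube, tsum_mul_tsum_parity hj ht]
    have e1 : ∑' p : ℤ × ℤ, (-1 : ℝ) ^ (p.1 + p.2) * (2 * ((p.1 + p.2 : ℤ) : ℝ) + 1) *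
        q ^ tri (p.1 + p.2) * q ^ tri (p.1 - p.2) = etaCube (q ^ 2) * phiR (-q) := by
      rw [← add_zero (etaCube _ * _),
        show (0 : ℝ) = (∑' n : ℤ, (-1 : ℝ) ^ n * (q ^ 2) ^ tri n) *
          (∑' n : ℤ, 2 * ((-1 : ℝ) ^ n * n * q ^ (n ^ 2))) by rw [tsum_mul_left, hz]; ring,
        etaCube, phiR_neg, tsum_mul_tsum_of_summable_norm hj2.norm hs.norm,
        tsum_mul_tsum_of_summable_norm hat2.norm (hn.mul_left 2).norm, ← p1.tsum_add p2]
      refine tsum_congr fun ⟨a, b⟩ => ?_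
      simp only
      rw [mul_assoc, ← zpow_add₀ h0, tri_add_add_tri_sub, zpow_add₀ h0, ← pow_zpow_two,
        zpow_add₀ (by norm_num : (-1 : ℝ) ≠ 0)]
      push_cast
      ring
    have e2 : ∑' p : ℤ × ℤ, (-1 : ℝ) ^ (p.1 + p.2 + 1) * (2 * ((p.1 + p.2 + 1 : ℤ) : ℝ) + 1) *
        q ^ tri (p.1 + p.2 + 1) * q ^ tri (p.1 - p.2) = etaCube (q ^ 2) * phiR (-q) := by
      rw [← add_zero (etaCube _ * _), mul_comm (etaCube _),
        show (0 : ℝ) = (∑' n : ℤ, 2 * ((-1 : ℝ) ^ (n + 1) * ((n + 1 : ℤ) : ℝ) * q ^ ((n + 1) ^ 2))) *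
          (∑' n : ℤ, (-1 : ℝ) ^ n * (q ^ 2) ^ tri n) by
            rw [tsum_mul_left, tsum_succ_int (fun n => (-1 : ℝ) ^ n * n * q ^ (n ^ 2)), hz]; ring,
        etaCube, phiR_neg, ← tsum_succ_int (fun n => (-1 : ℝ) ^ n * q ^ (n ^ 2)),
        tsum_mul_tsum_of_summable_norm hs.succ_int.norm hj2.norm,
        tsum_mul_tsum_of_summable_norm (hn.mul_left 2).succ_int.norm hat2.norm, ← p3.tsum_add p4]
      refine tsum_congr fun ⟨a, b⟩ => ?_
      simp only
      rw [mul_assoc, ← zpow_add₀ h0, tri_add_succ_add_tri_sub, zpow_add₀ h0, ← pow_zpow_two,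
        show a + b + 1 = (a + 1) + b by ring, zpow_add₀ (by norm_num : (-1 : ℝ) ≠ 0)]
      push_cast
      ring
    rw [e1, e2]; ring
  rw [tsum_tri h0 h1] at key
  linarith

end

/-! ### Differentiability of theta-like series -/

theorem hasDerivAt_tsum_mul_pow {ι : Type*} {w e : ι → ℕ} {c : ι → ℝ}
    (hw : ∀ r : ℝ, 0 ≤ r → r < 1 → ∀ k, Summable fun i => ((w i : ℝ) + 1) ^ k * r ^ w i)
    (hc : ∀ i, |c i| ≤ 2 * ((w i : ℝ) + 1) ^ 2) (he : ∀ i, w i ≤ e i + 1)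
    (he' : ∀ i, e i ≤ (w i + 1) ^ 2) {q : ℝ} (hq : |q| < 1) :
    HasDerivAt (fun y => ∑' i, c i * y ^ e i) (∑' i, c i * (e i * q ^ (e i - 1))) q := by
  obtain ⟨r, hqr, hr1⟩ := exists_between hq
  have hr0 : 0 < r := (abs_nonneg q).trans_lt hqr
  have hbound : ∀ i, r ^ (e i - 1) ≤ (r ^ 2)⁻¹ * r ^ w i := fun i => by
    rw [inv_mul_eq_div, le_div_iff₀ (by positivity), ← pow_add]
    exact pow_le_pow_of_le_one hr0.le hr1.le (by have := he i; omega)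
  refine hasDerivAt_tsum_of_isPreconnected (t := Metric.ball 0 r) (y₀ := 0)
    (u := fun i => 2 * (r ^ 2)⁻¹ * (((w i : ℝ) + 1) ^ 4 * r ^ w i))
    (g := fun i y => c i * y ^ e i) (g' := fun i y => c i * (e i * y ^ (e i - 1)))
    ((hw r hr0.le hr1 4).mul_left _) Metric.isOpen_ball
    (convex_ball 0 r).isPreconnected (fun i y _ => (hasDerivAt_pow (e i) y).const_mul _) ?_
    (Metric.mem_ball_self hr0) ?_ (by simpa using hqr)
  · intro i y hy
    have hy' : |y| < r := by simpa using hy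
    rw [norm_mul, norm_mul, norm_pow, Real.norm_eq_abs, Real.norm_eq_abs, Real.norm_eq_abs,
      Nat.abs_cast]
    have h1 : |y| ^ (e i - 1) ≤ (r ^ 2)⁻¹ * r ^ w i :=
      (pow_le_pow_left₀ (abs_nonneg y) hy'.le _).trans (hbound i)
    have h2 : (e i : ℝ) ≤ ((w i : ℝ) + 1) ^ 2 := by exact_mod_cast he' i
    calc |c i| * (e i * |y| ^ (e i - 1))
        ≤ (2 * ((w i : ℝ) + 1) ^ 2) * (((w i : ℝ) + 1) ^ 2 * ((r ^ 2)⁻¹ * r ^ w i)) := by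
          gcongr
          exact hc i
      _ = _ := by ring
  · refine Summable.of_norm_bounded ((hw (1 / 2) (by norm_num) (by norm_num) 2).mul_left 4)
      fun i => ?_
    rw [norm_mul, norm_pow, norm_zero, Real.norm_eq_abs]
    have h1 : (0 : ℝ) ^ e i ≤ 2 * (1 / 2) ^ w i := by
      rcases Nat.eq_zero_or_pos (e i) with h | h
      · rcases (show w i = 0 ∨ w i = 1 by have := he i; omega) with h' | h' <;> simp [h, h']
      · rw [zero_pow h.ne']; positivity
    calc |c i| * 0 ^ e i ≤ (2 * ((w i : ℝ) + 1) ^ 2) * (2 * (1 / 2) ^ w i) := by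
          gcongr
          exact hc i
      _ = _ := by ring

theorem summable_nat_poly_geometric (r : ℝ) (h0 : 0 ≤ r) (h1 : r < 1) (k : ℕ) :
    Summable fun n : ℕ => ((n : ℝ) + 1) ^ k * r ^ n :=
  (summable_int_poly_geometric h0 h1 k).comp_injective (i := fun n : ℕ => (n : ℤ))
    Nat.cast_injective

/-- The derivative of `phiR`. -/
noncomputable def dphi (q : ℝ) : ℝ :=
  ∑' n : ℤ, (1 : ℝ) * ((n.natAbs ^ 2 : ℕ) * q ^ (n.natAbs ^ 2 - 1))

/-- The derivative of `psiR`. -/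
noncomputable def dpsi (q : ℝ) : ℝ :=
  ∑' n : ℕ, (1 : ℝ) * ((n * (n + 1) / 2 : ℕ) * q ^ (n * (n + 1) / 2 - 1))

theorem phiR_eq_tsum_natAbs : phiR = fun q => ∑' n : ℤ, (1 : ℝ) * q ^ (n.natAbs ^ 2) := by
  ext q
  refine tsum_congr fun n => ?_
  rw [one_mul, ← zpow_natCast]
  push_cast
  rw [sq_abs]

theorem le_sq_add_one (m : ℕ) : m ≤ m ^ 2 + 1 := by nlinarith [Nat.zero_le m]

theorem le_tri_add_one (n : ℕ) : n ≤ n * (n + 1) / 2 + 1 := by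
  have := natAbs_sub_one_le_tri n
  rw [tri_natCast] at this
  omega

theorem tri_le (n : ℕ) : n * (n + 1) / 2 ≤ (n + 1) ^ 2 :=
  (Nat.div_le_self _ _).trans (by nlinarith)

theorem one_le_bound (x : ℝ) (hx : 0 ≤ x) : |(1 : ℝ)| ≤ 2 * (x + 1) ^ 2 := by
  rw [abs_one]; nlinarith

theorem hasDerivAt_phiR {q : ℝ} (hq : |q| < 1) : HasDerivAt phiR (dphi q) q := by
  rw [phiR_eq_tsum_natAbs]
  exact hasDerivAt_tsum_mul_pow (w := Int.natAbs) (c := fun _ => 1)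
    (fun r h0 h1 k => summable_int_poly_geometric h0 h1 k) (fun i => one_le_bound _ (by positivity))
    (fun i => le_sq_add_one _) (fun i => by gcongr; omega) hq

theorem hasDerivAt_psiR {q : ℝ} (hq : |q| < 1) : HasDerivAt psiR (dpsi q) q := by
  have : psiR = fun q => ∑' n : ℕ, (1 : ℝ) * q ^ (n * (n + 1) / 2) := by
    ext q; simp [psiR]
  rw [this]
  exact hasDerivAt_tsum_mul_pow (w := fun n : ℕ => n) (c := fun _ => 1)
    summable_nat_poly_geometric (fun i => one_le_bound _ (by positivity))
    le_tri_add_one tri_le hq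

theorem continuousAt_dphi : ContinuousAt dphi 0 := by
  have : dphi = fun q => ∑' n : ℤ, ((n.natAbs ^ 2 : ℕ) : ℝ) * q ^ (n.natAbs ^ 2 - 1) := by
    ext q; simp [dphi]
  rw [this]
  refine (hasDerivAt_tsum_mul_pow (w := Int.natAbs)
    (fun r h0 h1 k => summable_int_poly_geometric h0 h1 k) (fun i => ?_) (fun i => ?_)
    (fun i => ?_) (by simp)).continuousAt
  · rw [Nat.abs_cast]
    push_cast
    have : (0 : ℝ) ≤ i.natAbs := by positivity
    nlinarith
  · have := le_sq_add_one i.natAbs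
    rcases Nat.eq_zero_or_pos i.natAbs with h | h
    · simp [h]
    · have : i.natAbs ≤ i.natAbs ^ 2 := by nlinarith
      omega
  · exact (Nat.sub_le _ _).trans (by gcongr; omega)

theorem phiR_zero : phiR 0 = 1 := by
  rw [phiR, tsum_eq_single 0]
  · simp
  · intro n hn
    exact zero_zpow _ (pow_ne_zero 2 hn)

theorem psiR_zero : psiR 0 = 1 := by
  rw [psiR, tsum_eq_single 0]
  · simp
  · intro n hn
    refine zero_pow ?_
    have : 1 ≤ n := Nat.one_le_iff_ne_zero.mpr hn
    have : 2 ≤ n * (n + 1) := by nlinarith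
    omega

theorem dphi_zero : dphi 0 = 2 := by
  rw [dphi, tsum_eq_sum (s := {1, -1})]
  · simp; norm_num
  · intro n hn
    rcases Nat.eq_zero_or_pos n.natAbs with h | h
    · simp [h]
    · have h2 : 2 ≤ n.natAbs := by
        simp at hn; omega
      have : n.natAbs ^ 2 - 1 ≠ 0 := by
        have : 4 ≤ n.natAbs ^ 2 := by nlinarith
        omega
      rw [zero_pow this]; simp

theorem tri_toNat (n : ℤ) : ((tri n).toNat : ℤ) = tri n := by
  have := two_mul_tri n
  refine Int.toNat_of_nonneg ?_
  rcases le_or_gt 0 n with h | h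
  · nlinarith
  · nlinarith

theorem etaCube_eq_tsum_toNat :
    etaCube = fun q => ∑' n : ℤ, (-1 : ℝ) ^ n * (2 * n + 1) * q ^ (tri n).toNat := by
  ext q
  refine tsum_congr fun n => ?_
  rw [← zpow_natCast, tri_toNat]

theorem continuousAt_etaCube : ContinuousAt etaCube 0 := by
  rw [etaCube_eq_tsum_toNat]
  refine (hasDerivAt_tsum_mul_pow (w := Int.natAbs)
    (fun r h0 h1 k => summable_int_poly_geometric h0 h1 k) (fun i => ?_) (fun i => ?_)
    (fun i => ?_) (by simp)).continuousAt
  · refine (abs_alt_odd_le i).trans ?_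
    have : (0 : ℝ) ≤ i.natAbs := by positivity
    nlinarith
  · have := natAbs_sub_one_le_tri i
    have := tri_toNat i
    omega
  · have h := two_mul_tri i
    have h' := tri_toNat i
    zify
    rw [h']
    nlinarith [abs_nonneg i, le_abs_self i, sq_abs i]

theorem etaCube_zero : etaCube 0 = 2 := by
  rw [etaCube, tsum_eq_sum (s := {0, -1})]
  · simp [tri]
  · intro n hn
    have h := two_mul_tri n
    have : tri n ≠ 0 := fun h0 => by
      rw [h0] at h
      simp at hn
      rcases mul_eq_zero.mp h.symm with h | h <;> omega
    rw [zero_zpow _ this, mul_zero]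

/-! ### Positivity -/

theorem tendsto_pow_two_pow {q : ℝ} (h0 : 0 < q) (h1 : q < 1) :
    Tendsto (fun n : ℕ => q ^ 2 ^ n) atTop (𝓝[>] 0) :=
  tendsto_nhdsWithin_iff.mpr ⟨(tendsto_pow_atTop_nhds_zero_of_lt_one h0.le h1).comp
    (tendsto_pow_atTop_atTop_of_one_lt one_lt_two), Eventually.of_forall fun n => by simp; positivity⟩

/-- A function invariant under squaring is determined by its limit at `0`. -/
theorem eq_of_invariant_sq {f : ℝ → ℝ} {c : ℝ} (hf : ∀ q, 0 < q → q < 1 → f (q ^ 2) = f q)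
    (hl : Tendsto f (𝓝[>] 0) (𝓝 c)) {q : ℝ} (h0 : 0 < q) (h1 : q < 1) : f q = c := by
  have h := hl.comp (tendsto_pow_two_pow h0 h1)
  have hc : ∀ n : ℕ, f (q ^ 2 ^ n) = f q := by
    intro n
    induction n with
    | zero => simp
    | succ n ih =>
      rw [pow_succ, pow_mul, hf _ (by positivity) (pow_lt_one₀ h0.le h1 (by positivity)), ih]
  refine tendsto_nhds_unique ?_ h
  simp only [Function.comp_def, hc]
  exact tendsto_const_nhds

theorem pos_of_ne_zero_of_continuous {f : ℝ → ℝ} (hf : ∀ q, |q| < 1 → ContinuousAt f q)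
    (hne : ∀ q, |q| < 1 → f q ≠ 0) (h0 : 0 < f 0) {q : ℝ} (hq : |q| < 1) : 0 < f q := by
  by_contra hneg
  have hlt : f q < 0 := lt_of_le_of_ne (not_lt.mp hneg) (hne q hq)
  have hpre : IsPreconnected (f '' Metric.ball 0 1) :=
    (convex_ball (0 : ℝ) 1).isPreconnected.image f fun y hy =>
      (hf y (by simpa using hy)).continuousWithinAt
  obtain ⟨y, hy, hy0⟩ := hpre.Icc_subset ⟨q, by simpa using hq, rfl⟩
    ⟨0, by simp, rfl⟩ ⟨hlt.le, h0.le⟩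
  exact hne y (by simpa using hy) hy0

theorem phiR_pos_of_pos {q : ℝ} (h0 : 0 < q) (h1 : q < 1) : 0 < phiR q :=
  (summable_sq h0.ne' (by rwa [abs_of_pos h0])).tsum_pos (fun n => by positivity) 0 (by simp)

theorem continuousAt_phiR {q : ℝ} (hq : |q| < 1) : ContinuousAt phiR q :=
  (hasDerivAt_phiR hq).continuousAt

theorem continuousAt_psiR {q : ℝ} (hq : |q| < 1) : ContinuousAt psiR q :=
  (hasDerivAt_psiR hq).continuousAt

theorem phiR_neg_ne_zero {q : ℝ} (h0 : 0 < q) (h1 : q < 1) : phiR (-q) ≠ 0 := by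
  intro hz
  have hzero : ∀ n : ℕ, phiR (-q ^ 2 ^ n) = 0 := by
    intro n
    induction n with
    | zero => simpa using hz
    | succ n ih =>
      have hp : 0 < q ^ 2 ^ n := by positivity
      have hl : q ^ 2 ^ n < 1 := pow_lt_one₀ h0.le h1 (by positivity)
      have := phiR_mul_phiR_neg hp.ne' (by rwa [abs_of_pos hp])
      rw [ih, mul_zero, ← pow_mul, ← pow_succ] at this
      exact pow_eq_zero_iff two_ne_zero |>.mp this.symm
  have h : Tendsto (fun n : ℕ => phiR (-q ^ 2 ^ n)) atTop (𝓝 (phiR (-0))) := by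
    have hc : ContinuousAt (fun y => phiR (-y)) 0 :=
      (continuousAt_phiR (by simp)).comp continuousAt_neg
    exact hc.tendsto.comp ((tendsto_pow_two_pow h0 h1).mono_right nhdsWithin_le_nhds)
  simp only [hzero, neg_zero, phiR_zero] at h
  exact zero_ne_one (tendsto_nhds_unique tendsto_const_nhds h)

theorem phiR_pos {q : ℝ} (hq : |q| < 1) : 0 < phiR q := by
  refine pos_of_ne_zero_of_continuous (fun y hy => continuousAt_phiR hy) (fun y hy => ?_)
    (by rw [phiR_zero]; exact one_pos) hq
  rcases lt_trichotomy y 0 with h | rfl | h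
  · have := phiR_neg_ne_zero (neg_pos.mpr h) (by rwa [abs_of_neg h] at hy)
    rwa [neg_neg] at this
  · rw [phiR_zero]; exact one_ne_zero
  · exact (phiR_pos_of_pos h (by rwa [abs_of_pos h] at hy)).ne'

theorem psiR_pos_of_pos {q : ℝ} (h0 : 0 < q) (h1 : q < 1) : 0 < psiR q := by
  have h := (summable_tri h0.ne' (by rwa [abs_of_pos h0])).tsum_pos
    (fun n => by positivity) 0 (by simp [tri])
  rw [tsum_tri h0.ne' (by rwa [abs_of_pos h0])] at h
  linarith

theorem psiR_pos {q : ℝ} (hq : |q| < 1) : 0 < psiR q := by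
  refine pos_of_ne_zero_of_continuous (fun y hy => continuousAt_psiR hy) (fun y hy => ?_)
    (by rw [psiR_zero]; exact one_pos) hq
  rcases eq_or_ne y 0 with rfl | h
  · rw [psiR_zero]; exact one_ne_zero
  · intro hz
    have := psiR_sq h hy
    have h2 := psiR_pos_of_pos (q := y ^ 2) (by positivity) ((le_abs_self _).trans_lt (abs_sq_lt_one hy))
    rw [hz] at this
    have h3 := mul_pos h2 (phiR_pos hy)
    linarith

/-! ### Consequences of the quadratic relations -/

section

variable {q : ℝ}

theorem phiR_sq_add (h0 : q ≠ 0) (h1 : |q| < 1) :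
    phiR q ^ 2 + phiR (-q) ^ 2 = 2 * phiR (q ^ 2) ^ 2 := by
  have := phiR_sq h0 h1
  have h := phiR_sq (neg_ne_zero.mpr h0) (by rwa [abs_neg])
  rw [neg_sq, Even.neg_pow (by decide)] at h
  linarith

theorem phiR_sq_sub (h0 : q ≠ 0) (h1 : |q| < 1) :
    phiR q ^ 2 - phiR (-q) ^ 2 = 8 * q * psiR (q ^ 4) ^ 2 := by
  have := phiR_sq h0 h1
  have h := phiR_sq (neg_ne_zero.mpr h0) (by rwa [abs_neg])
  rw [neg_sq, Even.neg_pow (by decide)] at h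
  linarith

theorem psiR_mul_psiR_neg (h0 : q ≠ 0) (h1 : |q| < 1) :
    psiR q * psiR (-q) = psiR (q ^ 2) * phiR (-q ^ 2) := by
  have h1' : |-q| < 1 := by rwa [abs_neg]
  have hs := psiR_sq h0 h1
  have hs' := psiR_sq (neg_ne_zero.mpr h0) h1'
  have hp := phiR_mul_phiR_neg h0 h1
  rw [neg_sq] at hs'
  have := psiR_pos h1
  have := psiR_pos h1'
  have := psiR_pos (abs_sq_lt_one h1)
  have := phiR_pos (q := -q ^ 2) (by rw [abs_neg]; exact abs_sq_lt_one h1)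
  refine (sq_eq_sq₀ (by positivity) (by positivity)).mp ?_
  rw [mul_pow, mul_pow, hs, hs', ← hp]
  ring

theorem etaCube_eq (h0 : 0 < q) (h1 : q < 1) : etaCube q = 2 * psiR q * phiR (-q) ^ 2 := by
  have hinv : ∀ y : ℝ, 0 < y → y < 1 →
      etaCube (y ^ 2) / (psiR (y ^ 2) * phiR (-y ^ 2) ^ 2) =
        etaCube y / (psiR y * phiR (-y) ^ 2) := by
    intro y hy0 hy1
    have hy : |y| < 1 := by rwa [abs_of_pos hy0]
    have hyn : |-y| < 1 := by rwa [abs_neg]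
    have e1 := etaCube_mul_psiR hy0.ne' hy
    have e2 := psiR_sq hy0.ne' hy
    have e3 := phiR_mul_phiR_neg hy0.ne' hy
    have p1 := psiR_pos hy
    have p2 := phiR_pos hy
    have p3 := phiR_pos hyn
    have p4 := psiR_pos (abs_sq_lt_one hy)
    rw [← e3, div_eq_div_iff (by positivity) (by positivity)]
    linear_combination (-psiR y * phiR (-y)) * e1 + (etaCube y * phiR (-y)) * e2
  have hlim : Tendsto (fun y => etaCube y / (psiR y * phiR (-y) ^ 2)) (𝓝[>] 0) (𝓝 2) := by
    have hc : ContinuousAt (fun y => etaCube y / (psiR y * phiR (-y) ^ 2)) 0 := by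
      refine continuousAt_etaCube.div ((continuousAt_psiR (by simp)).mul
        (ContinuousAt.pow ?_ 2)) ?_
      · exact ContinuousAt.comp' (continuousAt_phiR (by simp)) continuousAt_neg
      · simp [psiR_zero, phiR_zero]
    have := hc.tendsto.mono_left (nhdsWithin_le_nhds (s := Set.Ioi 0))
    simpa [etaCube_zero, psiR_zero, phiR_zero] using this
  have h := eq_of_invariant_sq hinv hlim h0 h1
  have p1 := psiR_pos (q := q) (by rwa [abs_of_pos h0])
  have p3 := phiR_pos (q := -q) (by rwa [abs_neg, abs_of_pos h0])
  rw [div_eq_iff (by positivity)] at h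
  linarith

theorem hasDerivAt_phiR_neg (h1 : |q| < 1) :
    HasDerivAt (fun y => phiR (-y)) (-dphi (-q)) q := by
  have h := (hasDerivAt_phiR (q := -q) (by rwa [abs_neg])).comp q (hasDerivAt_neg q)
  simpa [Function.comp_def] using h

theorem hasDerivAt_sq (q : ℝ) : HasDerivAt (fun y : ℝ => y ^ 2) (2 * q) q := by
  simpa using hasDerivAt_pow 2 q

theorem hasDerivAt_phiR_sq (h1 : |q| < 1) :
    HasDerivAt (fun y => phiR (y ^ 2)) (dphi (q ^ 2) * (2 * q)) q :=
  HasDerivAt.comp (h := fun y : ℝ => y ^ 2) q (hasDerivAt_phiR (abs_sq_lt_one h1))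
    (hasDerivAt_sq q)

theorem hasDerivAt_phiR_neg_sq (h1 : |q| < 1) :
    HasDerivAt (fun y => phiR (-y ^ 2)) (-dphi (-q ^ 2) * (2 * q)) q :=
  HasDerivAt.comp (h := fun y : ℝ => y ^ 2) (h₂ := fun y => phiR (-y)) q
    (hasDerivAt_phiR_neg (abs_sq_lt_one h1)) (hasDerivAt_sq q)

theorem eventually_ne_zero_abs_lt_one (h0 : q ≠ 0) (h1 : |q| < 1) :
    ∀ᶠ y in 𝓝 q, y ≠ 0 ∧ |y| < 1 :=
  (eventually_ne_nhds h0).and (continuous_abs.continuousAt.eventually_lt continuousAt_const h1)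

theorem deriv_phiR_sq_add (h0 : q ≠ 0) (h1 : |q| < 1) :
    phiR q * dphi q - phiR (-q) * dphi (-q) = 4 * q * phiR (q ^ 2) * dphi (q ^ 2) := by
  have hl := ((hasDerivAt_phiR h1).pow 2).add ((hasDerivAt_phiR_neg h1).pow 2)
  have hr := ((hasDerivAt_phiR_sq h1).pow 2).const_mul 2
  have he := (eventually_ne_zero_abs_lt_one h0 h1).mono fun y hy => phiR_sq_add hy.1 hy.2
  have := hl.unique (hr.congr_of_eventuallyEq he)
  simp at this
  linarith

theorem deriv_phiR_mul_neg (h0 : q ≠ 0) (h1 : |q| < 1) :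
    dphi q * phiR (-q) - phiR q * dphi (-q) = -4 * q * phiR (-q ^ 2) * dphi (-q ^ 2) := by
  have hl := (hasDerivAt_phiR h1).mul (hasDerivAt_phiR_neg h1)
  have hr := (hasDerivAt_phiR_neg_sq h1).pow 2
  have he := (eventually_ne_zero_abs_lt_one h0 h1).mono fun y hy => phiR_mul_phiR_neg hy.1 hy.2
  have := hl.unique (hr.congr_of_eventuallyEq he)
  simp at this
  linarith

theorem phiR_log_deriv_of_pos (h0 : 0 < q) (h1 : q < 1) :
    4 * q * (dphi q * phiR (-q) + dphi (-q) * phiR q) =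
      phiR q * phiR (-q) * (phiR q ^ 4 - phiR (-q) ^ 4) := by
  set f : ℝ → ℝ := fun y => 4 * (dphi y / phiR y + dphi (-y) / phiR (-y)) /
    ((phiR y ^ 4 - phiR (-y) ^ 4) / y) with hf
  have hd : ∀ y : ℝ, 0 < y → y < 1 → phiR y ^ 2 - phiR (-y) ^ 2 ≠ 0 := fun y hy0 hy1 => by
    have hy : |y| < 1 := by rwa [abs_of_pos hy0]
    have := psiR_pos (q := y ^ 4) (by rw [abs_pow]; exact pow_lt_one₀ (abs_nonneg y) hy (by norm_num))
    rw [phiR_sq_sub hy0.ne' hy]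
    positivity
  have hinv : ∀ y, 0 < y → y < 1 → f (y ^ 2) = f y := by
    intro y hy0 hy1
    have hy : |y| < 1 := by rwa [abs_of_pos hy0]
    have e1 := phiR_sq_add hy0.ne' hy
    have e2 := phiR_mul_phiR_neg hy0.ne' hy
    have e3 := deriv_phiR_sq_add hy0.ne' hy
    have e4 := deriv_phiR_mul_neg hy0.ne' hy
    have p1 := phiR_pos hy
    have p2 := phiR_pos (q := -y) (by rwa [abs_neg])
    have p3 := phiR_pos (abs_sq_lt_one hy)
    have p4 := phiR_pos (q := -y ^ 2) (by rw [abs_neg]; exact abs_sq_lt_one hy)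
    have n1 := hd y hy0 hy1
    simp only [hf]
    generalize phiR y = p at *
    generalize phiR (-y) = m at *
    generalize phiR (y ^ 2) = P at *
    generalize phiR (-y ^ 2) = M at *
    generalize dphi y = p' at *
    generalize dphi (-y) = m' at *
    generalize dphi (y ^ 2) = P' at *
    generalize dphi (-y ^ 2) = M' at *
    have hP : P' / P = (p * p' - m * m') / (2 * y * (p ^ 2 + m ^ 2)) := by
      rw [e3, e1]; field_simp; norm_num
    have hM : M' / M = -(p' * m - p * m') / (4 * y * (p * m)) := by
      rw [e4, e2]; field_simp
    have hD : P ^ 4 - M ^ 4 = (p ^ 2 - m ^ 2) ^ 2 / 4 := by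
      linear_combination (-(P ^ 2 / 2) - (p ^ 2 + m ^ 2) / 4) * e1 + (M ^ 2 + p * m) * e2
    have hF : p ^ 4 - m ^ 4 = (p ^ 2 - m ^ 2) * (p ^ 2 + m ^ 2) := by ring
    rw [hP, hM, hD, hF]
    field_simp
    ring
  have hlim : Tendsto f (𝓝[>] 0) (𝓝 1) := by
    have hcn : ContinuousAt (fun y => 4 * (dphi y / phiR y + dphi (-y) / phiR (-y))) 0 := by
      have c1 : ContinuousAt (fun y => phiR (-y)) 0 :=
        ContinuousAt.comp' (continuousAt_phiR (by simp)) continuousAt_neg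
      have c2 : ContinuousAt (fun y => dphi (-y)) 0 :=
        ContinuousAt.comp' (by simpa using continuousAt_dphi) continuousAt_neg
      refine continuousAt_const.mul ((continuousAt_dphi.div (continuousAt_phiR (by simp)) ?_).add
        (c2.div c1 ?_))
      · simp [phiR_zero]
      · simp [phiR_zero]
    have hn := hcn.tendsto.mono_left (nhdsWithin_le_nhds (s := Set.Ioi 0))
    have hder : HasDerivAt (fun y => phiR y ^ 4 - phiR (-y) ^ 4) 16 0 := by
      have z : |(0 : ℝ)| < 1 := by simp
      have := ((hasDerivAt_phiR z).pow 4).sub ((hasDerivAt_phiR_neg z).pow 4)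
      refine this.congr_deriv ?_
      simp [phiR_zero, dphi_zero]
      norm_num
    have hs := hder.tendsto_slope_zero_right
    have hs' : Tendsto (fun y => (phiR y ^ 4 - phiR (-y) ^ 4) / y) (𝓝[>] 0) (𝓝 16) := by
      refine hs.congr fun y => ?_
      simp [div_eq_inv_mul]
    have := hn.div hs' (by norm_num)
    simp only [neg_zero, phiR_zero, dphi_zero] at this
    rw [show (4 * (2 / 1 + 2 / 1) / 16 : ℝ) = 1 by norm_num] at this
    exact this
  have h := eq_of_invariant_sq hinv hlim h0 h1
  have p1 := phiR_pos (q := q) (by rwa [abs_of_pos h0])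
  have p2 := phiR_pos (q := -q) (by rwa [abs_neg, abs_of_pos h0])
  have n1 := hd q h0 h1
  have n2 : phiR q ^ 4 - phiR (-q) ^ 4 ≠ 0 := by
    rw [show phiR q ^ 4 - phiR (-q) ^ 4 =
      (phiR q ^ 2 - phiR (-q) ^ 2) * (phiR q ^ 2 + phiR (-q) ^ 2) by ring]
    exact mul_ne_zero n1 (by positivity)
  simp only [hf] at h
  field_simp at h
  linarith

/-- The logarithmic derivative of `φ(q)/φ(-q)`. -/
theorem phiR_log_deriv (h0 : q ≠ 0) (h1 : |q| < 1) :
    4 * q * (dphi q * phiR (-q) + dphi (-q) * phiR q) =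
      phiR q * phiR (-q) * (phiR q ^ 4 - phiR (-q) ^ 4) := by
  rcases h0.lt_or_gt with h | h
  · have := phiR_log_deriv_of_pos (neg_pos.mpr h) (by rwa [abs_of_neg h] at h1)
    rw [neg_neg] at this
    linarith
  · exact phiR_log_deriv_of_pos h (by rwa [abs_of_pos h] at h1)

end

/-! ### The Lambert series of weight three -/

/-- The coefficient `Σ_{m odd} χ₋₈(m) Q^{(m(2j+1)-1)/2}` in closed form. -/
noncomputable def lambertCoeff (Q : ℝ) (j : ℤ) : ℝ :=
  Q ^ j * (1 + Q ^ (2 * j + 1)) / (1 + Q ^ (4 * j + 2))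

/-- The coefficients of the product of the series `Σ lambertCoeff Q j t^{2j+1}` with the
theta series `Σ (-1)ⁿ Q^{n²} t^{2n}`. -/
noncomputable def convCoeff (Q : ℝ) (j : ℤ) : ℝ :=
  ∑' n : ℤ, (-1 : ℝ) ^ n * Q ^ (n ^ 2) * lambertCoeff Q (j - n)

theorem tsum_tsum_shear {G : ℤ × ℤ → ℝ} (hG : Summable G) :
    ∑' j, ∑' n, G (j - n, n) = ∑' p, G p := by
  let E : ℤ × ℤ ≃ ℤ × ℤ :=
    { toFun := fun p => (p.1 - p.2, p.2)
      invFun := fun p => (p.1 + p.2, p.2)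
      left_inv := fun p => by simp
      right_inv := fun p => by simp }
  have hs : Summable (fun p : ℤ × ℤ => G (p.1 - p.2, p.2)) := E.summable_iff.mpr hG
  rw [← E.tsum_eq G]
  exact hs.tsum_prod.symm

theorem neg_one_zpow_add_one (n : ℤ) : (-1 : ℝ) ^ (n + 1) = -(-1) ^ n := by
  rw [zpow_add_one₀ (by norm_num)]; ring

theorem neg_one_zpow_one_sub (n : ℤ) : (-1 : ℝ) ^ (1 - n) = -(-1) ^ n := by
  rw [show 1 - n = -n + 1 by ring, neg_one_zpow_add_one, neg_one_zpow_neg]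

section

variable {Q : ℝ}

theorem one_add_zpow_pos (Q : ℝ) (j : ℤ) : 1 ≤ 1 + Q ^ (4 * j + 2) := by
  have : 0 ≤ Q ^ (4 * j + 2) := Even.zpow_nonneg ⟨2 * j + 1, by ring⟩ Q
  linarith

theorem lambertCoeff_eq (h0 : Q ≠ 0) (j : ℤ) :
    (Q ^ (-(2 * j + 1)) + Q ^ (2 * j + 1)) * lambertCoeff Q j = Q ^ (-(j + 1)) + Q ^ j := by
  have h := one_add_zpow_pos Q j
  have hne : Q ^ (2 * j + 1) ≠ 0 := zpow_ne_zero _ h0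
  have e1 : Q ^ (4 * j + 2) = (Q ^ (2 * j + 1)) ^ 2 := by
    rw [← zpow_natCast, ← zpow_mul]; ring_nf
  have e2 : Q ^ (-(j + 1)) = Q ^ j / Q ^ (2 * j + 1) := by
    rw [← zpow_sub₀ h0]; ring_nf
  rw [lambertCoeff, e2, zpow_neg]
  rw [e1] at h ⊢
  field_simp

theorem lambertCoeff_symm (h0 : Q ≠ 0) (j : ℤ) :
    lambertCoeff Q (-1 - j) = lambertCoeff Q j := by
  have hne : Q ^ (2 * j + 1) ≠ 0 := zpow_ne_zero _ h0
  have h1 := lambertCoeff_eq h0 j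
  have h2 := lambertCoeff_eq h0 (-1 - j)
  rw [show -(2 * (-1 - j) + 1) = 2 * j + 1 by ring, show 2 * (-1 - j) + 1 = -(2 * j + 1) by ring,
    show -(-1 - j + 1) = j by ring, show -1 - j = -(j + 1) by ring] at h2
  have hpos : Q ^ (-(2 * j + 1)) + Q ^ (2 * j + 1) ≠ 0 := by
    rw [zpow_neg]
    intro h
    have : (Q ^ (2 * j + 1)) * ((Q ^ (2 * j + 1))⁻¹ + Q ^ (2 * j + 1)) = 0 := by rw [h, mul_zero]
    rw [mul_add, mul_inv_cancel₀ hne] at this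
    nlinarith [mul_self_nonneg (Q ^ (2 * j + 1))]
  rw [show -1 - j = -(j + 1) by ring]
  refine mul_left_cancel₀ hpos ?_
  linarith

theorem abs_zpow_le_one (h1 : |Q| < 1) {k : ℤ} (hk : 0 ≤ k) : |Q ^ k| ≤ 1 := by
  lift k to ℕ using hk
  rw [zpow_natCast, abs_pow]
  exact pow_le_one₀ (abs_nonneg Q) h1.le

theorem abs_lambertCoeff_le_of_nonneg (h1 : |Q| < 1) {j : ℤ} (hj : 0 ≤ j) :
    |lambertCoeff Q j| ≤ 2 * |Q| ^ j := by
  have h := one_add_zpow_pos Q j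
  rw [lambertCoeff, abs_div, abs_of_pos (by linarith : 0 < 1 + Q ^ (4 * j + 2)), abs_mul, abs_zpow]
  have h2 : |1 + Q ^ (2 * j + 1)| ≤ 2 := by
    refine (abs_add_le _ _).trans ?_
    have := abs_zpow_le_one h1 (show 0 ≤ 2 * j + 1 by omega)
    rw [abs_one]; linarith
  refine (div_le_self (by positivity) h).trans ?_
  rw [mul_comm]
  gcongr

theorem abs_lambertCoeff_le (h0 : Q ≠ 0) (h1 : |Q| < 1) (j : ℤ) :
    |lambertCoeff Q j| ≤ 2 * |Q| ^ ((j.natAbs : ℤ) - 1) := by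
  have hpos : 0 < |Q| := abs_pos.mpr h0
  rcases le_or_gt 0 j with hj | hj
  · refine (abs_lambertCoeff_le_of_nonneg h1 hj).trans ?_
    gcongr 2 * ?_
    exact zpow_le_zpow_right_of_le_one₀ hpos h1.le (by omega)
  · rw [← lambertCoeff_symm h0]
    refine (abs_lambertCoeff_le_of_nonneg h1 (by omega)).trans ?_
    rw [show -1 - j = (j.natAbs : ℤ) - 1 by omega]

theorem summable_mul_of_abs_le {c f : ℤ → ℝ} (h0 : Q ≠ 0) (h1 : |Q| < 1) (k : ℕ) (C : ℝ)
    (hc : ∀ n, |c n| ≤ C * ((n.natAbs : ℝ) + 1) ^ k)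
    (hf : ∀ j, |f j| ≤ 2 * |Q| ^ ((j.natAbs : ℤ) - 1)) : Summable fun j => c j * f j := by
  have h := summable_mul_zpow (c := fun n => C * ((n.natAbs : ℝ) + 1) ^ k)
    (e := fun j => (j.natAbs : ℤ) - 1) (q := |Q|) (abs_ne_zero.mpr h0) (by rwa [abs_abs]) k C
    (fun n => le_of_eq (abs_of_nonneg ((abs_nonneg _).trans (hc n)))) (fun n => le_rfl)
  refine Summable.of_norm_bounded (h.mul_left 2) fun j => ?_
  rw [norm_mul, Real.norm_eq_abs, Real.norm_eq_abs]
  calc |c j| * |f j| ≤ (C * ((j.natAbs : ℝ) + 1) ^ k) * (2 * |Q| ^ ((j.natAbs : ℤ) - 1)) :=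
        mul_le_mul (hc j) (hf j) (abs_nonneg _) ((abs_nonneg _).trans (hc j))
    _ = _ := by ring

theorem abs_odd_pow_le (k : ℕ) (n : ℤ) :
    |(2 * n + 1 : ℝ) ^ k| ≤ 2 ^ k * ((n.natAbs : ℝ) + 1) ^ k := by
  rw [abs_pow, ← mul_pow]
  refine pow_le_pow_left₀ (abs_nonneg _) ?_ k
  have := abs_alt_odd_le n
  rwa [abs_mul, abs_negOnePow, one_mul, pow_one] at this

theorem summable_odd_pow_lambertCoeff (h0 : Q ≠ 0) (h1 : |Q| < 1) (k : ℕ) :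
    Summable fun j : ℤ => (2 * j + 1 : ℝ) ^ k * lambertCoeff Q j :=
  summable_mul_of_abs_le h0 h1 k (2 ^ k) (abs_odd_pow_le k) (abs_lambertCoeff_le h0 h1)

theorem summable_lambertCoeff (h0 : Q ≠ 0) (h1 : |Q| < 1) : Summable (lambertCoeff Q) := by
  simpa using summable_odd_pow_lambertCoeff h0 h1 0

theorem summable_alt_pow_mul_sq (h0 : Q ≠ 0) (h1 : |Q| < 1) (k : ℕ) :
    Summable fun n : ℤ => (n : ℝ) ^ k * ((-1 : ℝ) ^ n * Q ^ (n ^ 2)) := by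
  have := summable_mul_zpow (c := fun n : ℤ => (n : ℝ) ^ k * (-1) ^ n) h0 h1 k 1 (fun n => ?_)
    natAbs_sub_one_le_sq
  · simpa [mul_assoc] using this
  · rw [abs_mul, abs_negOnePow, mul_one, one_mul, abs_pow, Nat.cast_natAbs, Int.cast_abs]
    exact pow_le_pow_left₀ (abs_nonneg _) (by linarith) k

theorem summable_alt_zpow_mul_lambertCoeff (h0 : Q ≠ 0) (h1 : |Q| < 1) (e : ℤ → ℤ) (c j : ℤ)
    (he : ∀ n, (n.natAbs : ℤ) - 1 ≤ e n + c) :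
    Summable fun n : ℤ => (-1 : ℝ) ^ n * Q ^ e n * lambertCoeff Q (j - n) := by
  have hb : ∀ i, |lambertCoeff Q i| ≤ 2 * |Q|⁻¹ := fun i => by
    refine (abs_lambertCoeff_le h0 h1 i).trans ?_
    rw [← zpow_neg_one]
    gcongr 2 * ?_
    exact zpow_le_zpow_right_of_le_one₀ (abs_pos.mpr h0) h1.le (by omega)
  have h := (summable_mul_zpow (c := fun n => (-1 : ℝ) ^ n * lambertCoeff Q (j - n))
    (e := fun n => e n + c) h0 h1 0 (2 * |Q|⁻¹) (fun n => by
      rw [abs_mul, abs_negOnePow, one_mul, pow_zero, mul_one]; exact hb _) he).mul_left (Q ^ (-c))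
  refine h.congr fun n => ?_
  rw [zpow_add₀ h0, zpow_neg]
  have := zpow_ne_zero c h0
  field_simp

theorem tsum_alt_tri (Q : ℝ) : ∑' n : ℤ, (-1 : ℝ) ^ n * Q ^ tri n = 0 := by
  refine tsum_int_eq_zero_of_involution (-1) fun n => ?_
  rw [tri_neg_one_sub, show (-1 - n : ℤ) = -(n + 1) by ring, neg_one_zpow_neg,
    neg_one_zpow_add_one]
  ring

theorem sq_add_self_eq (n : ℤ) : n ^ 2 + n = 2 * tri n := by rw [two_mul_tri]; ring

theorem tsum_alt_sq_add_self (Q : ℝ) : ∑' n : ℤ, (-1 : ℝ) ^ n * Q ^ (n ^ 2 + n) = 0 := by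
  simp_rw [sq_add_self_eq, ← pow_zpow_two]
  exact tsum_alt_tri _

theorem tsum_alt_sq_sub_self (Q : ℝ) : ∑' n : ℤ, (-1 : ℝ) ^ n * Q ^ (n ^ 2 - n) = 0 := by
  refine tsum_int_eq_zero_of_involution 1 fun n => ?_
  rw [neg_one_zpow_one_sub]
  ring_nf

theorem summable_alt_sq_add_self (h0 : Q ≠ 0) (h1 : |Q| < 1) :
    Summable fun n : ℤ => (-1 : ℝ) ^ n * Q ^ (n ^ 2 + n) :=
  summable_mul_zpow h0 h1 0 1 (by simp) fun n => by
    have := natAbs_sub_one_le_tri n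
    have := tri_toNat n
    rw [sq_add_self_eq]; omega

theorem summable_alt_sq_sub_self (h0 : Q ≠ 0) (h1 : |Q| < 1) :
    Summable fun n : ℤ => (-1 : ℝ) ^ n * Q ^ (n ^ 2 - n) := by
  have := (Equiv.neg ℤ).summable_iff.mpr (summable_alt_sq_add_self h0 h1)
  refine this.congr fun n => ?_
  simp only [Function.comp_apply, Equiv.neg_apply, neg_one_zpow_neg]
  ring_nf

theorem convCoeff_rec (h0 : Q ≠ 0) (h1 : |Q| < 1) (j : ℤ) :
    convCoeff Q (j + 1) = -Q ^ (4 * j + 2) * convCoeff Q (j - 1) := by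
  have s1 : Summable fun n : ℤ => (-1 : ℝ) ^ n * Q ^ ((n + 1) ^ 2) * lambertCoeff Q (j - n) :=
    summable_alt_zpow_mul_lambertCoeff h0 h1 _ 0 j fun n => by
      have := natAbs_sub_one_le_sq n
      have := natAbs_sub_one_le_sq (n + 1)
      have h3 : ((n + 1).natAbs : ℤ) ≤ (n + 1) ^ 2 := by
        have := Int.natAbs_le_self_sq (n + 1); simpa using this
      omega
  have s2 : Summable fun n : ℤ => (-1 : ℝ) ^ n * Q ^ ((n - 1) ^ 2) * lambertCoeff Q (j - n) :=
    summable_alt_zpow_mul_lambertCoeff h0 h1 _ 0 j fun n => by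
      have h3 : ((n - 1).natAbs : ℤ) ≤ (n - 1) ^ 2 := by
        have := Int.natAbs_le_self_sq (n - 1); simpa using this
      omega
  have e1 : convCoeff Q (j + 1) =
      -∑' n : ℤ, (-1 : ℝ) ^ n * Q ^ ((n + 1) ^ 2) * lambertCoeff Q (j - n) := by
    rw [convCoeff, ← tsum_succ_int, ← tsum_neg]
    refine tsum_congr fun n => ?_
    rw [neg_one_zpow_add_one]; ring_nf
  have e2 : convCoeff Q (j - 1) =
      -∑' n : ℤ, (-1 : ℝ) ^ n * Q ^ ((n - 1) ^ 2) * lambertCoeff Q (j - n) := by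
    rw [convCoeff, ← tsum_succ_int (fun n : ℤ => (-1 : ℝ) ^ n * Q ^ ((n - 1) ^ 2) *
      lambertCoeff Q (j - n)), ← tsum_neg]
    refine tsum_congr fun n => ?_
    rw [neg_one_zpow_add_one]; ring_nf
  have t1 := summable_alt_sq_add_self h0 h1
  have t2 := summable_alt_sq_sub_self h0 h1
  have key : Q ^ (-2 * j - 2) *
        (∑' n : ℤ, (-1 : ℝ) ^ n * Q ^ ((n + 1) ^ 2) * lambertCoeff Q (j - n)) +
      Q ^ (2 * j) * (∑' n : ℤ, (-1 : ℝ) ^ n * Q ^ ((n - 1) ^ 2) * lambertCoeff Q (j - n)) =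
      Q ^ (-(j + 1)) * (∑' n : ℤ, (-1 : ℝ) ^ n * Q ^ (n ^ 2 + n)) +
        Q ^ j * (∑' n : ℤ, (-1 : ℝ) ^ n * Q ^ (n ^ 2 - n)) := by
    rw [← tsum_mul_left, ← tsum_mul_left, ← tsum_mul_left, ← tsum_mul_left,
      ← (s1.mul_left _).tsum_add (s2.mul_left _), ← (t1.mul_left _).tsum_add (t2.mul_left _)]
    refine tsum_congr fun n => ?_
    have h := lambertCoeff_eq h0 (j - n)
    have x1 : Q ^ (-2 * j - 2) * Q ^ ((n + 1) ^ 2) = Q ^ (n ^ 2) * Q ^ (-(2 * (j - n) + 1)) := by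
      rw [← zpow_add₀ h0, ← zpow_add₀ h0]; ring_nf
    have x2 : Q ^ (2 * j) * Q ^ ((n - 1) ^ 2) = Q ^ (n ^ 2) * Q ^ (2 * (j - n) + 1) := by
      rw [← zpow_add₀ h0, ← zpow_add₀ h0]; ring_nf
    have x3 : Q ^ (-(j + 1)) * Q ^ (n ^ 2 + n) = Q ^ (n ^ 2) * Q ^ (-(j - n + 1)) := by
      rw [← zpow_add₀ h0, ← zpow_add₀ h0]; ring_nf
    have x4 : Q ^ j * Q ^ (n ^ 2 - n) = Q ^ (n ^ 2) * Q ^ (j - n) := by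
      rw [← zpow_add₀ h0, ← zpow_add₀ h0]; ring_nf
    linear_combination ((-1 : ℝ) ^ n * lambertCoeff Q (j - n)) * (x1 + x2) -
      (-1 : ℝ) ^ n * (x3 + x4) + (-1 : ℝ) ^ n * Q ^ (n ^ 2) * h
  rw [tsum_alt_sq_add_self, tsum_alt_sq_sub_self] at key
  have x5 : Q ^ (4 * j + 2) * Q ^ (-2 * j - 2) = Q ^ (2 * j) := by
    rw [← zpow_add₀ h0]; ring_nf
  have hne : Q ^ (-2 * j - 2) ≠ 0 := zpow_ne_zero _ h0
  rw [e1, e2]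
  refine mul_left_cancel₀ hne ?_
  linear_combination -key - (∑' n : ℤ, (-1 : ℝ) ^ n * Q ^ ((n - 1) ^ 2) *
    lambertCoeff Q (j - n)) * x5

theorem convCoeff_symm (h0 : Q ≠ 0) (j : ℤ) : convCoeff Q (-1 - j) = convCoeff Q j := by
  rw [convCoeff, ← (Equiv.neg ℤ).tsum_eq, convCoeff]
  refine tsum_congr fun n => ?_
  rw [Equiv.neg_apply, neg_one_zpow_neg, neg_sq, ← lambertCoeff_symm h0 (j - n)]
  ring_nf

theorem convCoeff_natCast (h0 : Q ≠ 0) (h1 : |Q| < 1) (j : ℕ) :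
    convCoeff Q j = convCoeff Q 0 * (-Q ^ 2) ^ tri j ∧
      convCoeff Q (j + 1) = convCoeff Q 0 * (-Q ^ 2) ^ tri (j + 1) := by
  have hy : -Q ^ 2 ≠ 0 := neg_ne_zero.mpr (pow_ne_zero 2 h0)
  have step : ∀ i : ℤ, convCoeff Q (i - 1) = convCoeff Q 0 * (-Q ^ 2) ^ tri (i - 1) →
      convCoeff Q (i + 1) = convCoeff Q 0 * (-Q ^ 2) ^ tri (i + 1) := by
    intro i hi
    have ht : tri (i + 1) = tri (i - 1) + (2 * i + 1) := by
      have := two_mul_tri (i + 1)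
      have := two_mul_tri (i - 1)
      linarith
    have hp : (-Q ^ 2) ^ (2 * i + 1) = -Q ^ (4 * i + 2) := by
      rw [Odd.neg_zpow ⟨i, rfl⟩, pow_zpow_two]; ring_nf
    rw [convCoeff_rec h0 h1, hi, ht, zpow_add₀ hy, hp]
    ring
  induction j with
  | zero =>
    refine ⟨by simp [tri], ?_⟩
    have := step 0 (by
      have := convCoeff_symm h0 0
      simp only [sub_zero] at this
      simp [tri, this])
    simpa using this
  | succ j ih =>
    refine ⟨by exact_mod_cast ih.2, ?_⟩
    have := step (j + 1) (by simpa using ih.1)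
    exact_mod_cast this

theorem convCoeff_eq (h0 : Q ≠ 0) (h1 : |Q| < 1) (j : ℤ) :
    convCoeff Q j = convCoeff Q 0 * (-Q ^ 2) ^ tri j := by
  rcases le_or_gt 0 j with hj | hj
  · lift j to ℕ using hj
    exact (convCoeff_natCast h0 h1 j).1
  · obtain ⟨i, hi⟩ := Int.eq_ofNat_of_zero_le (show 0 ≤ -1 - j by omega)
    have := (convCoeff_natCast h0 h1 i).1
    rwa [← hi, convCoeff_symm h0, tri_neg_one_sub] at this

end

/-! ### Evaluation of the weight-three Lambert series -/

theorem tsum_int_eq_two_mul {f : ℤ → ℝ} (hf : Summable f) (h : ∀ n, f (-1 - n) = f n) :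
    ∑' n : ℤ, f n = 2 * ∑' n : ℕ, f n := by
  have e : ∀ n : ℕ, f (-((n : ℤ) + 1)) = f n := fun n => by
    rw [← h n]; congr 1; ring
  have hs : Summable fun n : ℕ => f n := hf.comp_injective Nat.cast_injective
  rw [tsum_of_nat_of_neg_add_one hs (hs.congr fun n => (e n).symm), tsum_congr e]
  ring

section

variable {Q : ℝ}

theorem tsum_sq_mul_alt_sq (Q : ℝ) :
    ∑' n : ℤ, (n : ℝ) ^ 2 * ((-1 : ℝ) ^ n * Q ^ (n ^ 2)) = -Q * dphi (-Q) := by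
  rw [dphi, ← tsum_mul_left]
  refine tsum_congr fun n => ?_
  rcases eq_or_ne n 0 with rfl | hn
  · simp
  have hpos : 0 < n.natAbs ^ 2 := pow_pos (Int.natAbs_pos.mpr hn) 2
  have e : (-1 : ℝ) ^ n * Q ^ (n ^ 2) = (-Q) ^ (n.natAbs ^ 2 - 1) * (-Q) := by
    rw [← pow_succ, Nat.sub_add_cancel hpos, ← neg_one_zpow_sq, ← mul_zpow, ← zpow_natCast]
    push_cast
    rw [sq_abs]; ring_nf
  rw [e]
  push_cast
  rw [Nat.cast_natAbs, Int.cast_abs, sq_abs]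
  ring

theorem summable_tri_mul_tri (h0 : Q ≠ 0) (h1 : |Q| < 1) :
    Summable fun n : ℤ => (tri n : ℝ) * Q ^ tri n := by
  refine summable_mul_zpow (c := fun n => (tri n : ℝ)) h0 h1 2 1 (fun n => ?_)
    natAbs_sub_one_le_tri
  have h : (2 : ℝ) * tri n = n * (n + 1) := by exact_mod_cast two_mul_tri n
  rw [Nat.cast_natAbs, Int.cast_abs, abs_le]
  rcases abs_cases (n : ℝ) with ⟨e, _⟩ | ⟨e, _⟩ <;> rw [e] <;> constructor <;> nlinarith

theorem tsum_tri_mul_tri (h0 : Q ≠ 0) (h1 : |Q| < 1) :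
    ∑' n : ℤ, (tri n : ℝ) * Q ^ tri n = 2 * (Q * dpsi Q) := by
  rw [tsum_int_eq_two_mul (summable_tri_mul_tri h0 h1) (fun n => by rw [tri_neg_one_sub]), dpsi,
    ← tsum_mul_left (a := Q)]
  refine congrArg (2 * ·) (tsum_congr fun n => ?_)
  rw [tri_natCast, zpow_natCast, Int.cast_natCast]
  rcases Nat.eq_zero_or_pos (n * (n + 1) / 2) with h | h
  · simp [h]
  · nth_rewrite 2 [← Nat.sub_add_cancel h]
    rw [pow_succ]; ring

theorem tsum_lambertCoeff_mul (h0 : Q ≠ 0) (h1 : |Q| < 1) :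
    (∑' j, lambertCoeff Q j) * phiR (-Q) = convCoeff Q 0 * (2 * psiR (-Q ^ 2)) := by
  have hy : -Q ^ 2 ≠ 0 := neg_ne_zero.mpr (pow_ne_zero 2 h0)
  have hy1 : |-Q ^ 2| < 1 := by rw [abs_neg]; exact abs_sq_lt_one h1
  have hh := summable_lambertCoeff h0 h1
  have hc := summable_alt_sq h0 h1
  have hG := summable_mul_of_summable_norm hh.norm hc.norm
  rw [phiR_neg, tsum_mul_tsum_of_summable_norm hh.norm hc.norm, ← tsum_tsum_shear hG,
    ← tsum_tri hy hy1, ← tsum_mul_left]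
  refine tsum_congr fun j => ?_
  rw [← convCoeff_eq h0 h1, convCoeff]
  exact tsum_congr fun n => mul_comm _ _

theorem tsum_sq_lambertCoeff_mul (h0 : Q ≠ 0) (h1 : |Q| < 1) :
    (∑' j : ℤ, (2 * j + 1 : ℝ) ^ 2 * lambertCoeff Q j) * phiR (-Q) -
        4 * (∑' j, lambertCoeff Q j) * (Q * dphi (-Q)) =
      convCoeff Q 0 * (2 * psiR (-Q ^ 2) - 16 * (Q ^ 2 * dpsi (-Q ^ 2))) := by
  have hy : -Q ^ 2 ≠ 0 := neg_ne_zero.mpr (pow_ne_zero 2 h0)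
  have hy1 : |-Q ^ 2| < 1 := by rw [abs_neg]; exact abs_sq_lt_one h1
  have k0 := summable_lambertCoeff h0 h1
  have k1 := summable_odd_pow_lambertCoeff h0 h1 1
  have k2 := summable_odd_pow_lambertCoeff h0 h1 2
  have c0 := summable_alt_sq h0 h1
  have c1 := summable_alt_pow_mul_sq h0 h1 1
  have c2 := summable_alt_pow_mul_sq h0 h1 2
  have z1 : ∑' n : ℤ, (n : ℝ) ^ 1 * ((-1 : ℝ) ^ n * Q ^ (n ^ 2)) = 0 := by
    refine tsum_int_eq_zero_of_involution 0 fun n => ?_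
    rw [zero_sub, neg_one_zpow_neg, neg_sq]; push_cast; ring
  have g2 := summable_mul_of_summable_norm k2.norm c0.norm
  have g1 := (summable_mul_of_summable_norm k1.norm c1.norm).mul_left 4
  have g0 := (summable_mul_of_summable_norm k0.norm c2.norm).mul_left 4
  have hG := (g2.add g1).add g0
  have hl := tsum_tsum_shear hG
  rw [(g2.add g1).tsum_add g0, g2.tsum_add g1, tsum_mul_left, tsum_mul_left,
    ← tsum_mul_tsum_of_summable_norm k2.norm c0.norm,
    ← tsum_mul_tsum_of_summable_norm k1.norm c1.norm,
    ← tsum_mul_tsum_of_summable_norm k0.norm c2.norm, z1, tsum_sq_mul_alt_sq, ← phiR_neg] at hl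
  have hr : ∑' j : ℤ, (8 * ((tri j : ℝ) * (-Q ^ 2) ^ tri j) + (-Q ^ 2) ^ tri j) =
      8 * (2 * (-Q ^ 2 * dpsi (-Q ^ 2))) + 2 * psiR (-Q ^ 2) := by
    rw [((summable_tri_mul_tri hy hy1).mul_left 8).tsum_add (summable_tri hy hy1), tsum_mul_left,
      tsum_tri_mul_tri hy hy1, tsum_tri hy hy1]
  have hm : ∀ j : ℤ, ∑' n : ℤ, ((2 * (j - n : ℤ) + 1 : ℝ) ^ 2 * lambertCoeff Q (j - n) *
        ((-1 : ℝ) ^ n * Q ^ (n ^ 2)) + 4 * ((2 * (j - n : ℤ) + 1 : ℝ) ^ 1 *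
        lambertCoeff Q (j - n) * ((n : ℝ) ^ 1 * ((-1 : ℝ) ^ n * Q ^ (n ^ 2)))) +
        4 * (lambertCoeff Q (j - n) * ((n : ℝ) ^ 2 * ((-1 : ℝ) ^ n * Q ^ (n ^ 2))))) =
      convCoeff Q 0 * (8 * ((tri j : ℝ) * (-Q ^ 2) ^ tri j) + (-Q ^ 2) ^ tri j) := by
    intro j
    have ht : (2 : ℝ) * tri j = j * (j + 1) := by exact_mod_cast two_mul_tri j
    have : convCoeff Q 0 * (8 * ((tri j : ℝ) * (-Q ^ 2) ^ tri j) + (-Q ^ 2) ^ tri j) =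
        (2 * j + 1) ^ 2 * convCoeff Q j := by
      rw [convCoeff_eq h0 h1 j]
      linear_combination 4 * convCoeff Q 0 * (-Q ^ 2) ^ tri j * ht
    rw [this, convCoeff, ← tsum_mul_left]
    refine tsum_congr fun n => ?_
    push_cast
    ring
  have h2 : ∑' j : ℤ, convCoeff Q 0 * (8 * ((tri j : ℝ) * (-Q ^ 2) ^ tri j) + (-Q ^ 2) ^ tri j) =
      _ := (tsum_congr hm).symm.trans hl
  rw [tsum_mul_left, hr] at h2
  linear_combination -h2

end

/-- The difference of the indicators of `0 ≤ m` and `0 ≤ m + n`. -/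
def stepDiff (m n : ℤ) : ℝ := (if 0 ≤ m then 1 else 0) - (if 0 ≤ m + n then 1 else 0)

theorem tsum_stepDiff (n : ℤ) : ∑' m : ℤ, stepDiff m n = -n := by
  rcases le_or_gt 0 n with hn | hn
  · rw [tsum_eq_sum (s := Finset.Ico (-n) 0), Finset.sum_congr rfl (g := fun _ => (-1 : ℝ))]
    · rw [Finset.sum_const, Int.card_Ico, nsmul_eq_mul, zero_sub, neg_neg]
      have : ((n.toNat : ℤ) : ℝ) = n := by rw [Int.toNat_of_nonneg hn]
      rw [Int.cast_natCast] at this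
      rw [this]; ring
    · intro m hm
      rw [Finset.mem_Ico] at hm
      rw [stepDiff, if_neg (by omega), if_pos (by omega)]; norm_num
    · intro m hm
      rw [Finset.mem_Ico] at hm
      rw [stepDiff]
      by_cases h : 0 ≤ m
      · rw [if_pos h, if_pos (by omega)]; norm_num
      · rw [if_neg h, if_neg (by omega)]; norm_num
  · rw [tsum_eq_sum (s := Finset.Ico 0 (-n)), Finset.sum_congr rfl (g := fun _ => (1 : ℝ))]
    · rw [Finset.sum_const, Int.card_Ico, nsmul_eq_mul, sub_zero, mul_one]
      have : (((-n).toNat : ℤ) : ℝ) = ((-n : ℤ) : ℝ) := by rw [Int.toNat_of_nonneg (by omega)]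
      rw [Int.cast_natCast, Int.cast_neg] at this
      exact this
    · intro m hm
      rw [Finset.mem_Ico] at hm
      rw [stepDiff, if_pos (by omega), if_neg (by omega)]; norm_num
    · intro m hm
      rw [Finset.mem_Ico] at hm
      rw [stepDiff]
      by_cases h : 0 ≤ m
      · rw [if_pos h, if_pos (by omega)]; norm_num
      · rw [if_neg h, if_neg (by omega)]; norm_num

theorem abs_stepDiff_le {r : ℝ} (h0 : 0 < r) (h1 : r < 1) (m n : ℤ) :
    |stepDiff m n| ≤ r ^ ((m.natAbs : ℤ) - n.natAbs) := by
  have hp : 0 < r ^ ((m.natAbs : ℤ) - n.natAbs) := zpow_pos h0 _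
  rw [stepDiff]
  by_cases h : 0 ≤ m <;> by_cases h' : 0 ≤ m + n
  · simpa [h, h'] using hp.le
  · have := one_le_zpow_of_nonpos₀ h0 h1.le (show (m.natAbs : ℤ) - n.natAbs ≤ 0 by omega)
    simpa [h, h'] using this
  · have := one_le_zpow_of_nonpos₀ h0 h1.le (show (m.natAbs : ℤ) - n.natAbs ≤ 0 by omega)
    simpa [h, h'] using this
  · simpa [h, h'] using hp.le

section

variable {Q : ℝ}

theorem summable_alt_mul_stepDiff (h0 : Q ≠ 0) (h1 : |Q| < 1) :
    Summable fun p : ℤ × ℤ => (-1 : ℝ) ^ p.2 * Q ^ (p.2 ^ 2 - p.2) * stepDiff p.1 p.2 := by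
  have hr : 0 < |Q| := abs_pos.mpr h0
  have s1 : Summable fun m : ℤ => |Q| ^ m.natAbs := by
    simpa using summable_int_poly_geometric hr.le h1 0
  have s2 : Summable fun n : ℤ => |Q| ^ (n ^ 2 - n - n.natAbs) := by
    have := (summable_mul_zpow (c := fun _ => 1) (e := fun n : ℤ => n ^ 2 - n - n.natAbs + 3)
      hr.ne' (by rwa [abs_abs]) 0 1 (by simp) (fun n => by
        rcases le_or_gt 0 n with hn | hn
        · have : (n.natAbs : ℤ) = n := by omega
          rw [this]; nlinarith [sq_nonneg (n - 1), sq_nonneg (n - 2)]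
        · have : (n.natAbs : ℤ) = -n := by omega
          rw [this]; nlinarith [sq_nonneg (n + 1)])).mul_left (|Q| ^ (-3 : ℤ))
    refine this.congr fun n => ?_
    rw [one_mul, ← zpow_add₀ hr.ne']
    ring_nf
  refine Summable.of_norm_bounded (summable_mul_of_summable_norm s1.norm s2.norm) fun p => ?_
  rw [norm_mul, norm_mul, Real.norm_eq_abs, Real.norm_eq_abs, Real.norm_eq_abs, abs_negOnePow,
    one_mul, abs_zpow]
  refine (mul_le_mul_of_nonneg_left (abs_stepDiff_le hr h1 _ _) (zpow_nonneg hr.le _)).trans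
    (le_of_eq ?_)
  rw [← zpow_natCast, ← zpow_add₀ hr.ne', ← zpow_add₀ hr.ne']
  ring_nf

theorem tsum_alt_mul_stepDiff (h0 : Q ≠ 0) (h1 : |Q| < 1) :
    ∑' p : ℤ × ℤ, (-1 : ℝ) ^ p.2 * Q ^ (p.2 ^ 2 - p.2) * stepDiff p.1 p.2 =
      psiR (Q ^ 2) * phiR (-Q ^ 2) ^ 2 := by
  have hs := summable_alt_mul_stepDiff h0 h1
  have h2 : 0 < Q ^ 2 := by positivity
  have h21 : |Q ^ 2| < 1 := abs_sq_lt_one h1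
  rw [← (Equiv.prodComm ℤ ℤ).tsum_eq]
  refine (Summable.tsum_prod ((Equiv.prodComm ℤ ℤ).summable_iff.mpr hs)).trans ?_
  have e : ∀ n : ℤ, ∑' m : ℤ, (-1 : ℝ) ^ n * Q ^ (n ^ 2 - n) * stepDiff m n =
      -((-1 : ℝ) ^ n * n * Q ^ (n ^ 2 - n)) := fun n => by
    rw [tsum_mul_left, tsum_stepDiff]; ring
  have e2 : etaCube (Q ^ 2) = 2 * ∑' n : ℤ, -((-1 : ℝ) ^ n * n * Q ^ (n ^ 2 - n)) := by
    have t0 := summable_etaCube h2.ne' h21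
    have t1 : Summable fun n : ℤ => (-1 : ℝ) ^ n * (Q ^ 2) ^ tri n :=
      summable_mul_zpow h2.ne' h21 0 1 (by simp) natAbs_sub_one_le_tri
    have := t0.tsum_add t1
    rw [tsum_alt_tri, add_zero] at this
    rw [etaCube, ← this, ← tsum_mul_left,
      ← tsum_succ_int fun n : ℤ => 2 * -((-1 : ℝ) ^ n * n * Q ^ (n ^ 2 - n))]
    refine tsum_congr fun n => ?_
    rw [neg_one_zpow_add_one, pow_zpow_two, ← sq_add_self_eq,
      show (n + 1) ^ 2 - (n + 1) = n ^ 2 + n by ring]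
    push_cast
    ring
  have e3 := etaCube_eq h2 (by rwa [abs_of_pos h2] at h21)
  refine (tsum_congr e).trans ?_
  linarith

/-- The coefficient `lambertCoeff Q j * Q ^ (-j)` minus its limit as `j → ±∞`. -/
noncomputable def lambertDefect (Q : ℝ) (j : ℤ) : ℝ :=
  lambertCoeff Q j * Q ^ (-j) - if 0 ≤ j then 1 else 0

theorem abs_lambertDefect_le (h0 : Q ≠ 0) (h1 : |Q| < 1) (j : ℤ) :
    |lambertDefect Q j| ≤ 2 * |Q| ^ ((j.natAbs : ℤ) - 1) := by
  have hr : 0 < |Q| := abs_pos.mpr h0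
  rw [lambertDefect]
  by_cases hj : 0 ≤ j
  · have h := one_add_zpow_pos Q j
    have e1 : Q ^ (4 * j + 2) = Q ^ (2 * j + 1) * Q ^ (2 * j + 1) := by
      rw [← zpow_add₀ h0]; ring_nf
    have e : lambertCoeff Q j * Q ^ (-j) - 1 =
        Q ^ (2 * j + 1) * (1 - Q ^ (2 * j + 1)) / (1 + Q ^ (4 * j + 2)) := by
      have := zpow_ne_zero j h0
      have h' : 1 + Q ^ (4 * j + 2) ≠ 0 := by linarith
      rw [lambertCoeff, zpow_neg]
      field_simp
      rw [e1]; ring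
    have hb := abs_zpow_le_one h1 (show 0 ≤ 2 * j + 1 by omega)
    rw [if_pos hj, e, abs_div, abs_of_pos (by linarith : 0 < 1 + Q ^ (4 * j + 2))]
    refine (div_le_self (abs_nonneg _) h).trans ?_
    rw [abs_mul, abs_zpow, mul_comm]
    refine mul_le_mul ?_ (zpow_le_zpow_right_of_le_one₀ hr h1.le (by omega))
      (zpow_nonneg hr.le _) two_pos.le
    refine (abs_sub _ _).trans ?_
    rw [abs_one]; linarith
  · rw [if_neg hj, sub_zero, abs_mul]
    have := abs_zpow_le_one h1 (show 0 ≤ -j by omega)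
    exact (mul_le_of_le_one_right (abs_nonneg _) this).trans (abs_lambertCoeff_le h0 h1 j)

theorem tsum_neg_one_zpow_tri_mul_sq (h0 : Q ≠ 0) (h1 : |Q| < 1) :
    ∑' j : ℤ, (-1 : ℝ) ^ tri j * Q ^ (j ^ 2) = phiR (-Q ^ 4) := by
  have hs : Summable fun j : ℤ => (-1 : ℝ) ^ tri j * Q ^ (j ^ 2) :=
    summable_mul_zpow h0 h1 0 1 (by simp) natAbs_sub_one_le_sq
  have hn : ∑' j : ℤ, (-1 : ℝ) ^ tri (-j) * Q ^ ((-j) ^ 2) =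
      ∑' j : ℤ, (-1 : ℝ) ^ tri j * Q ^ (j ^ 2) := 
    (Equiv.neg ℤ).tsum_eq fun j : ℤ => (-1 : ℝ) ^ tri j * Q ^ (j ^ 2)
  have hs' : Summable fun j : ℤ => (-1 : ℝ) ^ tri (-j) * Q ^ ((-j) ^ 2) :=
    (Equiv.neg ℤ).summable_iff.mpr hs
  have hneg : ∀ j : ℤ, (-1 : ℝ) ^ tri (-j) * Q ^ ((-j) ^ 2) =
      (-1 : ℝ) ^ j * ((-1 : ℝ) ^ tri j * Q ^ (j ^ 2)) := fun j => by
    have : tri (-j) = -j + tri j := by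
      have := two_mul_tri (-j)
      have := two_mul_tri j
      nlinarith
    rw [this, neg_sq, zpow_add₀ (by norm_num), neg_one_zpow_neg]
    ring
  have key : 2 * ∑' j : ℤ, (-1 : ℝ) ^ tri j * Q ^ (j ^ 2) =
      ∑' j : ℤ, (1 + (-1 : ℝ) ^ j) * ((-1 : ℝ) ^ tri j * Q ^ (j ^ 2)) := by
    rw [two_mul]
    nth_rewrite 2 [← hn]
    rw [← hs.tsum_add hs']
    refine tsum_congr fun j => ?_
    rw [hneg]; ring
  have hinj : Function.Injective fun i : ℤ => 2 * i := fun a b h => by simpa using h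
  have hsupp : Function.support
      (fun j : ℤ => (1 + (-1 : ℝ) ^ j) * ((-1 : ℝ) ^ tri j * Q ^ (j ^ 2))) ⊆
      Set.range fun i : ℤ => 2 * i := by
    intro j hj
    rcases Int.even_or_odd' j with ⟨i, rfl | rfl⟩
    · exact ⟨i, rfl⟩
    · refine absurd ?_ hj
      simp only [Odd.neg_one_zpow (⟨i, rfl⟩ : Odd (2 * i + 1))]
      ring
  rw [← hinj.tsum_eq hsupp] at key
  have h4 : phiR (-Q ^ 4) = ∑' n : ℤ, (-1 : ℝ) ^ n * (Q ^ 4) ^ (n ^ 2) := phiR_neg _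
  have : ∑' i : ℤ, (1 + (-1 : ℝ) ^ (2 * i)) * ((-1 : ℝ) ^ tri (2 * i) * Q ^ ((2 * i) ^ 2)) =
      2 * phiR (-Q ^ 4) := by
    rw [h4, ← tsum_mul_left]
    refine tsum_congr fun i => ?_
    have ht : tri (2 * i) = i ^ 2 + i ^ 2 + i := by
      have := two_mul_tri (2 * i)
      linarith
    rw [Even.neg_one_zpow (even_two_mul i), ht, zpow_add₀ (by norm_num),
      Even.neg_one_zpow ⟨i ^ 2, rfl⟩, show (2 * i) ^ 2 = ((4 : ℕ) : ℤ) * i ^ 2 by push_cast; ring,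
      zpow_mul, zpow_natCast]
    ring
  rw [this] at key
  linarith

theorem convCoeff_zero_mul (h0 : Q ≠ 0) (h1 : |Q| < 1) :
    convCoeff Q 0 * phiR (-Q ^ 4) = psiR (Q ^ 2) * phiR (-Q ^ 2) ^ 2 := by
  have hc := summable_alt_sq_sub_self h0 h1
  have hd : Summable (lambertDefect Q) := by
    simpa using summable_mul_of_abs_le (c := fun _ => 1) h0 h1 0 1 (by simp)
      (abs_lambertDefect_le h0 h1)
  have g1 := summable_mul_of_summable_norm hd.norm hc.norm
  have g2 := summable_alt_mul_stepDiff h0 h1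
  have hl := tsum_tsum_shear (g1.add g2)
  rw [g1.tsum_add g2, ← tsum_mul_tsum_of_summable_norm hd.norm hc.norm, tsum_alt_sq_sub_self,
    mul_zero, zero_add, tsum_alt_mul_stepDiff h0 h1] at hl
  rw [← hl, ← tsum_neg_one_zpow_tri_mul_sq h0 h1, ← tsum_mul_left]
  refine tsum_congr fun j => ?_
  have ht := two_mul_tri j
  have e : convCoeff Q 0 * ((-1 : ℝ) ^ tri j * Q ^ (j ^ 2)) = Q ^ (-j) * convCoeff Q j := by
    rw [convCoeff_eq h0 h1 j, show -Q ^ 2 = (-1) * Q ^ 2 by ring, mul_zpow, pow_zpow_two, ht,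
      show j ^ 2 = -j + j * (j + 1) by ring, zpow_add₀ h0]
    ring
  have hsum := summable_alt_zpow_mul_lambertCoeff h0 h1 (fun n => n ^ 2) 0 j
    (by simpa using natAbs_sub_one_le_sq)
  have e' : ∑' n : ℤ, (Q ^ (-j) * ((-1 : ℝ) ^ n * Q ^ (n ^ 2) * lambertCoeff Q (j - n)) -
      (if 0 ≤ j then 1 else 0) * ((-1 : ℝ) ^ n * Q ^ (n ^ 2 - n))) = Q ^ (-j) * convCoeff Q j := by
    rw [(hsum.mul_left _).tsum_sub (hc.mul_left _), tsum_mul_left, tsum_mul_left,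
      tsum_alt_sq_sub_self, mul_zero, sub_zero, convCoeff]
  rw [e, ← e']
  refine tsum_congr fun n => ?_
  have x : Q ^ (n ^ 2 - n) * Q ^ (-(j - n)) = Q ^ (-j) * Q ^ (n ^ 2) := by
    rw [← zpow_add₀ h0, ← zpow_add₀ h0]; ring_nf
  simp only [lambertDefect, stepDiff, sub_add_cancel]
  linear_combination -((-1 : ℝ) ^ n * lambertCoeff Q (j - n)) * x

end

section

variable {Q : ℝ}

theorem eight_mul_psiR_pow_four (h0 : Q ≠ 0) (h1 : |Q| < 1) :
    8 * Q * psiR (-Q ^ 2) ^ 4 = (phiR Q ^ 2 - phiR (-Q) ^ 2) * (phiR Q * phiR (-Q)) := by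
  have hy : -Q ^ 2 ≠ 0 := neg_ne_zero.mpr (pow_ne_zero 2 h0)
  have hy1 : |-Q ^ 2| < 1 := by rw [abs_neg]; exact abs_sq_lt_one h1
  have h := psiR_sq hy hy1
  rw [neg_sq, ← pow_mul] at h
  rw [phiR_sq_sub h0 h1, phiR_mul_phiR_neg h0 h1]
  linear_combination 8 * Q * (psiR (-Q ^ 2) ^ 2 + psiR (Q ^ (2 * 2)) * phiR (-Q ^ 2)) * h

theorem deriv_eight_mul_psiR_pow_four (h0 : Q ≠ 0) (h1 : |Q| < 1) :
    8 * psiR (-Q ^ 2) ^ 4 - 64 * Q ^ 2 * psiR (-Q ^ 2) ^ 3 * dpsi (-Q ^ 2) =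
      2 * (phiR Q * dphi Q + phiR (-Q) * dphi (-Q)) * (phiR Q * phiR (-Q)) +
        (phiR Q ^ 2 - phiR (-Q) ^ 2) * (dphi Q * phiR (-Q) - phiR Q * dphi (-Q)) := by
  have hy1 : |-Q ^ 2| < 1 := by rw [abs_neg]; exact abs_sq_lt_one h1
  have hp := hasDerivAt_phiR h1
  have hm := hasDerivAt_phiR_neg h1
  have hs : HasDerivAt (fun y : ℝ => psiR (-y ^ 2)) (dpsi (-Q ^ 2) * -(2 * Q)) Q :=
    HasDerivAt.comp (h := fun y : ℝ => -y ^ 2) Q (hasDerivAt_psiR hy1) (hasDerivAt_sq Q).neg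
  have hl := ((hasDerivAt_id Q).const_mul 8).mul (hs.pow 4)
  have hr := ((hp.pow 2).sub (hm.pow 2)).mul (hp.mul hm)
  have he := (eventually_ne_zero_abs_lt_one h0 h1).mono fun y hy =>
    eight_mul_psiR_pow_four hy.1 hy.2
  have := hl.unique (hr.congr_of_eventuallyEq he)
  simp only [id, Pi.pow_apply, Pi.sub_apply, Pi.mul_apply] at this
  norm_num at this
  linear_combination this

/-- The Lambert series `Σ (2j+1)² Qʲ (1+Q^{2j+1})/(1+Q^{4j+2})` as a product of theta functions. -/
theorem tsum_sq_lambertCoeff (h0 : Q ≠ 0) (h1 : |Q| < 1) :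
    ∑' j : ℤ, (2 * j + 1 : ℝ) ^ 2 * lambertCoeff Q j =
      phiR Q * phiR (Q ^ 2) * (3 * psiR Q ^ 4 - psiR (-Q) ^ 4) := by
  have h2 := pow_ne_zero 2 h0
  have h21 := abs_sq_lt_one h1
  have h41 : |-Q ^ 4| < 1 := by
    rw [abs_neg, abs_pow]; exact pow_lt_one₀ (abs_nonneg Q) h1 (by norm_num)
  have hy1 : |-Q ^ 2| < 1 := by rwa [abs_neg]
  have hm1 : |-Q| < 1 := by rwa [abs_neg]
  have hm := (phiR_pos hm1).ne'
  have hΨ := (psiR_pos hy1).ne'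
  have h4 := (phiR_pos h41).ne'
  have e0 := tsum_lambertCoeff_mul h0 h1
  have e2 := tsum_sq_lambertCoeff_mul h0 h1
  have ea := convCoeff_zero_mul h0 h1
  have eψ := psiR_mul_psiR_neg h2 h21
  rw [← pow_mul] at eψ
  norm_num only at eψ
  have epm := phiR_mul_phiR_neg h0 h1
  have ka := eight_mul_psiR_pow_four h0 h1
  have kd := deriv_eight_mul_psiR_pow_four h0 h1
  have kl := phiR_log_deriv h0 h1
  have kadd := phiR_sq_add h0 h1
  have s1 := psiR_sq h0 h1
  have s2 := psiR_sq (neg_ne_zero.mpr h0) hm1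
  have s3 := psiR_sq h2 h21
  rw [neg_sq] at s2
  rw [← pow_mul] at s3
  norm_num only at s3
  set S0 := ∑' j, lambertCoeff Q j
  set S2 := ∑' j : ℤ, (2 * j + 1 : ℝ) ^ 2 * lambertCoeff Q j
  set p := phiR Q
  set m := phiR (-Q)
  set Ψ := psiR (-Q ^ 2)
  set a := convCoeff Q 0
  have ea' : a * Ψ = psiR (Q ^ 4) * (p * m) := by
    refine mul_left_cancel₀ h4 ?_
    linear_combination Ψ * ea + phiR (-Q ^ 2) ^ 2 * eψ - phiR (-Q ^ 4) * psiR (Q ^ 4) * epm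
  have hR : 4 * m * (Ψ - 8 * Q ^ 2 * dpsi (-Q ^ 2)) + 16 * Q * dphi (-Q) * Ψ =
      m * Ψ * (3 * p ^ 2 - m ^ 2) * (p ^ 2 + m ^ 2) := by
    refine mul_left_cancel₀ (mul_ne_zero (mul_ne_zero (by norm_num : (8 : ℝ) ≠ 0) h0)
      (pow_ne_zero 3 hΨ)) ?_
    linear_combination 4 * m * Q * kd + (16 * Q * dphi (-Q) -
      m * (3 * p ^ 2 - m ^ 2) * (p ^ 2 + m ^ 2)) * ka + m * (3 * p ^ 2 - m ^ 2) * kl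
  have f1 : psiR Q ^ 4 = psiR (Q ^ 4) * phiR (Q ^ 2) * p ^ 2 := by
    linear_combination (psiR Q ^ 2 + psiR (Q ^ 2) * p) * s1 + p ^ 2 * s3
  have f2 : psiR (-Q) ^ 4 = psiR (Q ^ 4) * phiR (Q ^ 2) * m ^ 2 := by
    linear_combination (psiR (-Q) ^ 2 + psiR (Q ^ 2) * m) * s2 + m ^ 2 * s3
  rw [f1, f2]
  refine mul_left_cancel₀ (mul_ne_zero two_ne_zero (pow_ne_zero 2 hm)) ?_
  linear_combination 2 * m * e2 + 8 * Q * dphi (-Q) * e0 + a * hR +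
    m * (3 * p ^ 2 - m ^ 2) * (p ^ 2 + m ^ 2) * ea' +
    psiR (Q ^ 4) * p * m ^ 2 * (3 * p ^ 2 - m ^ 2) * kadd

end

/-! ### Termwise integration -/

theorem neg_one_pow_tri_add_two (n : ℕ) :
    (-1 : ℝ) ^ ((n + 2) * (n + 2 + 1) / 2) = -(-1 : ℝ) ^ (n * (n + 1) / 2) := by
  have : (n + 2) * (n + 2 + 1) / 2 = n * (n + 1) / 2 + 2 * (n + 1) + 1 := by
    rw [show (n + 2) * (n + 2 + 1) = n * (n + 1) + (2 * (n + 1) + 1) * 2 by ring,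
      Nat.add_mul_div_right _ _ two_pos]
    ring
  rw [this, pow_succ, pow_add, pow_mul]
  norm_num

theorem abs_neg_one_pow_mul (k : ℕ) (y : ℝ) : |(-1 : ℝ) ^ k * y| = |y| := by
  rw [abs_mul, abs_pow, abs_neg, abs_one, one_pow, one_mul]

theorem tsum_neg_one_pow_tri_mul_pow {w : ℝ} (h0 : 0 ≤ w) (h1 : w < 1) :
    ∑' n : ℕ, (-1 : ℝ) ^ (n * (n + 1) / 2) * w ^ n = (1 - w) / (1 + w ^ 2) := by
  have hs : Summable fun n : ℕ => (-1 : ℝ) ^ (n * (n + 1) / 2) * w ^ n := by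
    refine Summable.of_norm_bounded (summable_geometric_of_lt_one h0 h1) fun n => ?_
    rw [Real.norm_eq_abs, abs_neg_one_pow_mul, abs_of_nonneg (by positivity)]
  have h := hs.sum_add_tsum_nat_add 2
  have e : ∀ n : ℕ, (-1 : ℝ) ^ ((n + 2) * (n + 2 + 1) / 2) * w ^ (n + 2) =
      -w ^ 2 * ((-1 : ℝ) ^ (n * (n + 1) / 2) * w ^ n) := fun n => by
    rw [neg_one_pow_tri_add_two]; ring
  rw [tsum_congr e, tsum_mul_left, Finset.sum_range_succ, Finset.sum_range_one] at h
  norm_num at h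
  rw [eq_div_iff (by positivity)]
  linarith

theorem summable_sq_mul_pow {q : ℝ} (h0 : 0 ≤ q) (h1 : q < 1) :
    Summable fun p : ℕ × ℕ =>
      (2 * (p.2 : ℝ) + 1) ^ 2 * q ^ (2 * p.2 + 2 * p.1 * (2 * p.2 + 1)) := by
  have s2 : Summable fun j : ℕ => 4 * (((j : ℝ) + 1) ^ 2 * q ^ j) :=
    (summable_nat_poly_geometric q h0 h1 2).mul_left 4
  refine Summable.of_nonneg_of_le (fun p => by positivity) (fun p => ?_)
    (summable_mul_of_summable_norm (summable_geometric_of_lt_one h0 h1).norm s2.norm)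
  have : q ^ (2 * p.2 + 2 * p.1 * (2 * p.2 + 1)) ≤ q ^ (p.1 + p.2) :=
    pow_le_pow_of_le_one h0 h1.le (by nlinarith [Nat.zero_le (p.1 * p.2)])
  calc _ ≤ (4 * ((p.2 : ℝ) + 1) ^ 2) * q ^ (p.1 + p.2) :=
        mul_le_mul (by nlinarith [Nat.cast_nonneg (α := ℝ) p.2]) this (by positivity)
          (by positivity)
    _ = _ := by rw [pow_add]; ring

theorem lambertCoeff_neg_sq (u : ℝ) (j : ℕ) :
    lambertCoeff (-u ^ 2) j = (-1 : ℝ) ^ j * (u ^ (2 * j) *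
      ((1 - u ^ (2 * (2 * j + 1))) / (1 + (u ^ (2 * (2 * j + 1))) ^ 2))) := by
  have e1 : (-u ^ 2) ^ (2 * (j : ℤ) + 1) = -u ^ (2 * (2 * j + 1)) := by
    rw [show 2 * (j : ℤ) + 1 = ((2 * j + 1 : ℕ) : ℤ) by push_cast; ring, zpow_natCast,
      Odd.neg_pow ⟨j, rfl⟩, ← pow_mul]
  have e2 : (-u ^ 2) ^ (4 * (j : ℤ) + 2) = (u ^ (2 * (2 * j + 1))) ^ 2 := by
    rw [show 4 * (j : ℤ) + 2 = ((2 * (2 * j + 1) : ℕ) : ℤ) by push_cast; ring, zpow_natCast,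
      Even.neg_pow ⟨2 * j + 1, by ring⟩, ← pow_mul, ← pow_mul]
    ring_nf
  rw [lambertCoeff, e1, e2, zpow_natCast, neg_pow, ← pow_mul]
  ring

/-- The double series expansion of the theta product. -/
theorem hasSum_theta_product {u : ℝ} (h0 : 0 < u) (h1 : u < 1) :
    HasSum (fun p : ℕ × ℕ => 2 * ((-1 : ℝ) ^ (p.1 * (p.1 + 1) / 2 + p.2) *
      ((2 * (p.2 : ℝ) + 1) ^ 2 * u ^ (2 * p.2 + 2 * p.1 * (2 * p.2 + 1)))))
      (phiR (-u ^ 2) * phiR (u ^ 4) * (3 * psiR (-u ^ 2) ^ 4 - psiR (u ^ 2) ^ 4)) := by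
  have hQ0 : -u ^ 2 ≠ 0 := neg_ne_zero.mpr (by positivity)
  have hQ1 : |-u ^ 2| < 1 := by
    rw [abs_neg, abs_pow, abs_of_pos h0]; exact pow_lt_one₀ h0.le h1 two_ne_zero
  have hs : Summable fun p : ℕ × ℕ => (-1 : ℝ) ^ (p.1 * (p.1 + 1) / 2 + p.2) *
      ((2 * (p.2 : ℝ) + 1) ^ 2 * u ^ (2 * p.2 + 2 * p.1 * (2 * p.2 + 1))) := by
    refine Summable.of_norm_bounded (summable_sq_mul_pow h0.le h1) fun p => ?_
    rw [Real.norm_eq_abs, abs_neg_one_pow_mul, abs_of_nonneg (by positivity)]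
  have key := tsum_sq_lambertCoeff hQ0 hQ1
  rw [tsum_int_eq_two_mul (summable_odd_pow_lambertCoeff hQ0 hQ1 2) (fun n => by
    rw [lambertCoeff_symm hQ0]; push_cast; ring), neg_sq, neg_neg, ← pow_mul] at key
  rw [← key]
  have hsum : ∑' p : ℕ × ℕ, (-1 : ℝ) ^ (p.1 * (p.1 + 1) / 2 + p.2) *
      ((2 * (p.2 : ℝ) + 1) ^ 2 * u ^ (2 * p.2 + 2 * p.1 * (2 * p.2 + 1))) =
      ∑' j : ℕ, (2 * ((j : ℤ) : ℝ) + 1) ^ 2 * lambertCoeff (-u ^ 2) j := by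
    rw [← (Equiv.prodComm ℕ ℕ).tsum_eq]
    refine (Summable.tsum_prod ((Equiv.prodComm ℕ ℕ).summable_iff.mpr hs)).trans ?_
    refine tsum_congr fun j => ?_
    rw [lambertCoeff_neg_sq, ← tsum_neg_one_pow_tri_mul_pow (by positivity)
      (pow_lt_one₀ h0.le h1 (by omega)), ← tsum_mul_left, ← tsum_mul_left, ← tsum_mul_left]
    refine tsum_congr fun n => ?_
    simp only [Function.comp_apply, Equiv.prodComm_apply, Prod.swap_prod_mk, Int.cast_natCast]
    rw [pow_add, pow_add, ← pow_mul u, show 2 * n * (2 * j + 1) = 2 * (2 * j + 1) * n by ring]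
    ring
  rw [← hsum]
  exact hs.hasSum.mul_left 2

theorem integral_theta_product {q : ℝ} (h0 : 0 < q) (h1 : q < 1) :
    HasSum (fun p : ℕ × ℕ => 2 * ((-1 : ℝ) ^ (p.1 * (p.1 + 1) / 2 + p.2) *
      ((2 * (p.2 : ℝ) + 1) / (2 * (p.1 : ℝ) + 1) * q ^ ((2 * p.1 + 1) * (2 * p.2 + 1)))))
      (∫ u in (0 : ℝ)..q,
        phiR (-u ^ 2) * phiR (u ^ 4) * (3 * psiR (-u ^ 2) ^ 4 - psiR (u ^ 2) ^ 4)) := by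
  have hb := (summable_sq_mul_pow h0.le h1).mul_left 2
  have h := intervalIntegral.hasSum_integral_of_dominated_convergence (μ := MeasureTheory.volume)
    (a := 0) (b := q)
    (F := fun (p : ℕ × ℕ) (u : ℝ) => 2 * ((-1 : ℝ) ^ (p.1 * (p.1 + 1) / 2 + p.2) *
      ((2 * (p.2 : ℝ) + 1) ^ 2 * u ^ (2 * p.2 + 2 * p.1 * (2 * p.2 + 1)))))
    (f := fun u : ℝ => phiR (-u ^ 2) * phiR (u ^ 4) * (3 * psiR (-u ^ 2) ^ 4 - psiR (u ^ 2) ^ 4))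
    (fun p _ => 2 * ((2 * (p.2 : ℝ) + 1) ^ 2 * q ^ (2 * p.2 + 2 * p.1 * (2 * p.2 + 1))))
    (fun p => (by fun_prop : Continuous _).aestronglyMeasurable)
    (fun p => Eventually.of_forall fun u hu => ?_)
    (Eventually.of_forall fun u hu => hb)
    intervalIntegrable_const
    (Eventually.of_forall fun u hu => ?_)
  · refine h.congr_fun fun p => ?_
    have e : 2 * p.2 + 2 * p.1 * (2 * p.2 + 1) + 1 = (2 * p.1 + 1) * (2 * p.2 + 1) := by ring
    have e' : ((2 * p.2 + 2 * p.1 * (2 * p.2 + 1) : ℕ) : ℝ) + 1 =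
        (2 * (p.1 : ℝ) + 1) * (2 * (p.2 : ℝ) + 1) := by exact_mod_cast e
    rw [intervalIntegral.integral_const_mul, intervalIntegral.integral_const_mul,
      intervalIntegral.integral_const_mul, integral_pow, e', e, zero_pow (by positivity), sub_zero]
    have h2 : (2 * (p.2 : ℝ) + 1) ≠ 0 := by positivity
    have h3 : (2 * (p.1 : ℝ) + 1) ≠ 0 := by positivity
    field_simp
  · rw [Set.uIoc_of_le h0.le] at hu
    have := hu.1
    rw [Real.norm_eq_abs, abs_mul, abs_neg_one_pow_mul, abs_two, abs_of_nonneg (by positivity)]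
    have := hu.2
    gcongr
  · rw [Set.uIoc_of_le h0.le] at hu
    exact hasSum_theta_product hu.1 (hu.2.trans_lt h1)

/-! ### The lattice sum -/

theorem summable_one_div_add_int_sq (w : ℂ) : Summable fun n : ℤ => 1 / (w + n) ^ 2 := by
  refine (EisensteinSeries.linear_right_summable w 1 (k := 2) le_rfl).congr fun n => ?_
  simp [zpow_ofNat]

theorem tsum_neg_one_pow_eq_tsum_int {f : ℝ → ℝ} (hodd : ∀ y, f (-y) = -f y)
    (hf : Summable fun n : ℤ => f (4 * n + 1)) :
    ∑' k : ℕ, (-1 : ℝ) ^ k * f (2 * k + 1) = ∑' n : ℤ, f (4 * n + 1) := by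
  let F : ℤ → ℝ := fun n => f (4 * n + 1)
  let G : ℕ → ℝ := fun k => (-1) ^ k * f (2 * k + 1)
  have s1 : Summable fun n : ℕ => F n := hf.comp_injective Nat.cast_injective
  have s2 : Summable fun n : ℕ => F (-((n : ℤ) + 1)) :=
    hf.comp_injective (i := fun n : ℕ => -((n : ℤ) + 1)) fun a b h => by simpa using h
  have e1 : ∀ n : ℕ, F n = G (2 * n) := fun n => by
    simp only [F, G, pow_mul]
    push_cast
    norm_num
    ring_nf
  have e2 : ∀ n : ℕ, F (-((n : ℤ) + 1)) = G (2 * n + 1) := fun n => by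
    simp only [F, G, pow_succ, pow_mul]
    norm_num
    rw [← hodd]
    ring_nf
  have h := tsum_of_nat_of_neg_add_one s1 s2
  simp only [e1, e2] at h s1 s2
  exact (h.trans (tsum_even_add_odd s1 s2)).symm

/-- The difference of the two `q`-expansions at `(±1 + ia)/4`. -/
theorem tsum_int_div_sq {a : ℝ} (ha : 0 < a) :
    Summable (fun n : ℤ => (4 * n + 1 : ℝ) / ((4 * n + 1) ^ 2 + a ^ 2) ^ 2) ∧
    ∑' n : ℤ, (4 * n + 1 : ℝ) / ((4 * n + 1) ^ 2 + a ^ 2) ^ 2 =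
      π ^ 2 / (8 * a) * ∑' j : ℕ, (-1 : ℝ) ^ j * (2 * j + 1) * exp (-π * a / 2) ^ (2 * j + 1) := by
  set z : ℝ := exp (-π * a / 2) with hz
  have hz1 : z < 1 := by
    rw [hz, exp_lt_one_iff]
    nlinarith [mul_pos pi_pos ha]
  have hz0 : 0 < z := exp_pos _
  let w₁ : UpperHalfPlane := ⟨(1 + a * Complex.I) / 4, by simp; positivity⟩
  let w₂ : UpperHalfPlane := ⟨(-1 + a * Complex.I) / 4, by simp; positivity⟩
  have q₁ : Complex.exp (2 * π * Complex.I * w₁) = Complex.I * z := by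
    have : 2 * π * Complex.I * ((1 + a * Complex.I) / 4) =
        π / 2 * Complex.I + ((-π * a / 2 : ℝ) : ℂ) := by
      push_cast
      linear_combination (π * a / 2 : ℂ) * Complex.I_sq
    rw [show (w₁ : ℂ) = (1 + a * Complex.I) / 4 from rfl, this, Complex.exp_add,
      Complex.exp_pi_div_two_mul_I, hz, Complex.ofReal_exp]
  have q₂ : Complex.exp (2 * π * Complex.I * w₂) = -Complex.I * z := by
    have : 2 * π * Complex.I * ((-1 + a * Complex.I) / 4) =
        -π / 2 * Complex.I + ((-π * a / 2 : ℝ) : ℂ) := by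
      push_cast
      linear_combination (π * a / 2 : ℂ) * Complex.I_sq
    rw [show (w₂ : ℂ) = (-1 + a * Complex.I) / 4 from rfl, this, Complex.exp_add,
      Complex.exp_neg_pi_div_two_mul_I, hz, Complex.ofReal_exp]
  have h₁ := EisensteinSeries.qExpansion_identity (k := 1) le_rfl w₁
  have h₂ := EisensteinSeries.qExpansion_identity (k := 1) le_rfl w₂
  rw [q₁] at h₁
  rw [q₂] at h₂
  have s₁ := summable_one_div_add_int_sq w₁
  have s₂ := (Equiv.neg ℤ).summable_iff.mpr (summable_one_div_add_int_sq w₂)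
  rw [← (Equiv.neg ℤ).tsum_eq] at h₂
  have hd := s₁.tsum_sub s₂
  have ht : ∀ n : ℤ, 1 / ((w₁ : ℂ) + n) ^ 2 -
      ((fun n : ℤ => 1 / ((w₂ : ℂ) + n) ^ 2) ∘ (Equiv.neg ℤ)) n =
      (-64 * Complex.I * a) * (((4 * n + 1 : ℝ) / ((4 * n + 1) ^ 2 + a ^ 2) ^ 2 : ℝ) : ℂ) := by
    intro n
    have hA : ((4 * n + 1 : ℝ) ^ 2 + a ^ 2 : ℝ) ≠ 0 := by positivity
    have hA' : ((4 * n + 1 : ℂ) ^ 2 + (a : ℂ) ^ 2) ≠ 0 := by exact_mod_cast hA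
    have hf : (4 * n + 1 + a * Complex.I : ℂ) * (4 * n + 1 - a * Complex.I) =
        (4 * n + 1) ^ 2 + a ^ 2 := by
      linear_combination -(a : ℂ) ^ 2 * Complex.I_sq
    have hp : (4 * n + 1 + a * Complex.I : ℂ) ≠ 0 := left_ne_zero_of_mul (hf ▸ hA')
    have hm : (4 * n + 1 - a * Complex.I : ℂ) ≠ 0 := right_ne_zero_of_mul (hf ▸ hA')
    have e₁ : (w₁ : ℂ) + n = (4 * n + 1 + a * Complex.I) / 4 := by
      change (1 + a * Complex.I) / 4 + n = _; ring
    have e₂ : (w₂ : ℂ) + ((-n : ℤ) : ℂ) = -((4 * n + 1 - a * Complex.I) / 4) := by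
      change (-1 + a * Complex.I) / 4 + ((-n : ℤ) : ℂ) = _; push_cast; ring
    simp only [Function.comp_apply, Equiv.neg_apply]
    rw [e₁, e₂]
    push_cast
    rw [← hf]
    field_simp
    ring
  have hne : (-64 * Complex.I * a : ℂ) ≠ 0 := by
    simp [ha.ne']
  have hr : ∑' r : ℕ, ((r : ℂ) ^ 1 * (Complex.I * z) ^ r - (r : ℂ) ^ 1 * (-Complex.I * z) ^ r) =
      2 * Complex.I * ((∑' j : ℕ, (-1 : ℝ) ^ j * (2 * j + 1) * z ^ (2 * j + 1) : ℝ) : ℂ) := by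
    have hinj : Function.Injective fun j : ℕ => 2 * j + 1 := fun a b h => by simpa using h
    rw [← hinj.tsum_eq, Complex.ofReal_tsum, ← tsum_mul_left]
    · refine tsum_congr fun j => ?_
      have hI : (Complex.I : ℂ) ^ (2 * j + 1) = (-1) ^ j * Complex.I := by
        rw [pow_succ, pow_mul, Complex.I_sq]
      rw [mul_pow, mul_pow, Odd.neg_pow ⟨j, rfl⟩, hI]
      push_cast
      ring
    · intro r hr
      rcases Nat.even_or_odd' r with ⟨j, rfl | rfl⟩
      · refine absurd ?_ hr
        simp only [neg_mul, Even.neg_pow (even_two_mul j)]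
        ring
      · exact ⟨j, rfl⟩
  have hg : ∀ c : ℂ, ‖c‖ = 1 → Summable fun r : ℕ => (r : ℂ) ^ 1 * (c * z) ^ r := fun c hc =>
    summable_pow_mul_geometric_of_norm_lt_one 1 (by
      rw [norm_mul, hc, one_mul, Complex.norm_real, Real.norm_eq_abs, abs_of_pos hz0]; exact hz1)
  have hreal : Summable (fun n : ℤ => (4 * n + 1 : ℝ) / ((4 * n + 1) ^ 2 + a ^ 2) ^ 2) :=
    Complex.summable_ofReal.mp ((summable_mul_left_iff hne).mp ((s₁.sub s₂).congr ht))
  refine ⟨hreal, ?_⟩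
  rw [tsum_congr ht, tsum_mul_left, ← Complex.ofReal_tsum] at hd
  have hd' := hd.trans (congrArg₂ (· - ·) h₁ h₂)
  simp only [← mul_sub] at hd'
  rw [← (hg _ Complex.norm_I).tsum_sub (hg _ (by simp)), hr] at hd'
  have ha' : (a : ℂ) ≠ 0 := by exact_mod_cast ha.ne'
  refine Complex.ofReal_injective ?_
  refine mul_left_cancel₀ hne ?_
  rw [hd']
  push_cast
  field_simp
  rw [Nat.factorial_one, Complex.I_sq]
  ring

theorem tsum_neg_one_pow_mul_div_sq {y : ℝ} (hy : 0 < y) :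
    ∑' k : ℕ, (-1 : ℝ) ^ k * ((2 * k + 1) / (2 * (2 * k + 1) ^ 2 + y ^ 2) ^ 2) =
      π ^ 2 / (16 * √2 * y) *
        ∑' j : ℕ, (-1 : ℝ) ^ j * (2 * j + 1) * exp (-π * y / √8) ^ (2 * j + 1) := by
  have h2 : 0 < √2 := by positivity
  have hsq : √2 ^ 2 = 2 := Real.sq_sqrt two_pos.le
  have h8 : √8 = 2 * √2 := by
    rw [show (8 : ℝ) = 2 ^ 2 * 2 by norm_num, Real.sqrt_mul (by norm_num),
      Real.sqrt_sq two_pos.le]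
  obtain ⟨hs, ht⟩ := tsum_int_div_sq (a := y / √2) (by positivity)
  have he : -π * (y / √2) / 2 = -π * y / √8 := by rw [h8]; field_simp
  rw [he] at ht
  have hodd := tsum_neg_one_pow_eq_tsum_int (f := fun A => A / (A ^ 2 + (y / √2) ^ 2) ^ 2)
    (fun A => by rw [neg_sq, neg_div]) hs
  have hk : ∀ k : ℕ, (-1 : ℝ) ^ k * ((2 * k + 1) / (2 * (2 * k + 1) ^ 2 + y ^ 2) ^ 2) =
      1 / 4 * ((-1 : ℝ) ^ k * ((2 * k + 1) / ((2 * k + 1) ^ 2 + (y / √2) ^ 2) ^ 2)) := fun k => by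
    have : 2 * (2 * k + 1 : ℝ) ^ 2 + y ^ 2 = 2 * ((2 * k + 1) ^ 2 + (y / √2) ^ 2) := by
      rw [div_pow, hsq]; ring
    have hp : (2 * k + 1 : ℝ) ^ 2 + (y / √2) ^ 2 ≠ 0 := by positivity
    rw [this]
    field_simp
    norm_num
  rw [tsum_congr hk, tsum_mul_left, hodd, ht, ← mul_assoc]
  congr 1
  field_simp
  rw [hsq]
  norm_num

theorem summable_sqrt_one_div_odd_cube : Summable fun n : ℕ => √(1 / (2 * (n : ℝ) + 1) ^ 3) := by
  have h := (summable_nat_add_iff 1).mpr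
    (Real.summable_one_div_nat_rpow (p := 3 / 2) |>.mpr (by norm_num))
  refine Summable.of_nonneg_of_le (fun n => Real.sqrt_nonneg _) (fun n => ?_) h
  have hn : (0 : ℝ) ≤ n := Nat.cast_nonneg n
  have e : ((n : ℝ) + 1) ^ (3 / 2 : ℝ) = √(((n : ℝ) + 1) ^ 3) := by
    rw [Real.sqrt_eq_rpow, ← Real.rpow_natCast, ← Real.rpow_mul (by positivity)]
    norm_num
  push_cast
  rw [e, ← Real.sqrt_one, ← Real.sqrt_div zero_le_one, Real.sqrt_one]
  gcongr
  linarith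

theorem summable_lattice {x : ℝ} (hx : 0 < x) :
    Summable fun p : ℕ × ℕ => (-1 : ℝ) ^ (p.1 * (p.1 + 1) / 2 + p.2) * (2 * (p.2 : ℝ) + 1) /
      (2 * (2 * (p.2 : ℝ) + 1) ^ 2 + x ^ 2 * (2 * (p.1 : ℝ) + 1) ^ 2) ^ 2 := by
  have hs := summable_sqrt_one_div_odd_cube
  refine Summable.of_norm_bounded
    ((summable_mul_of_summable_norm hs.norm hs.norm).mul_left √(1 / (16 * x ^ 3))) fun p => ?_
  rw [mul_div_assoc, Real.norm_eq_abs, abs_neg_one_pow_mul, abs_of_nonneg (by positivity),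
    ← Real.sqrt_mul (by positivity), ← Real.sqrt_mul (by positivity)]
  refine Real.le_sqrt_of_sq_le ?_
  set A : ℝ := 2 * (p.2 : ℝ) + 1
  set B : ℝ := 2 * (p.1 : ℝ) + 1
  have hA : 0 < A := by positivity
  have hB : 0 < B := by positivity
  have h1 : 2 * A ^ 2 ≤ 2 * A ^ 2 + x ^ 2 * B ^ 2 := by nlinarith [sq_nonneg (x * B)]
  have h2 : 2 * x * A * B ≤ 2 * A ^ 2 + x ^ 2 * B ^ 2 := by
    nlinarith [sq_nonneg (A - x * B), sq_nonneg A]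
  set P := 2 * A ^ 2 + x ^ 2 * B ^ 2
  have hP : 0 < P := by positivity
  have h4 : 2 * A ^ 2 * (2 * x * A * B) ^ 3 ≤ P * P ^ 3 := by gcongr
  rw [div_pow, div_mul_div_comm, div_mul_div_comm, div_le_div_iff₀ (by positivity) (by positivity)]
  calc A ^ 2 * (16 * x ^ 3 * (B ^ 3 * A ^ 3)) = 2 * A ^ 2 * (2 * x * A * B) ^ 3 := by ring
    _ ≤ P * P ^ 3 := h4
    _ = _ := by ring

/-- For `x > 0`, with `q = e^{-πx/√8}`,
`F_{(2,2)}(x) = (9π²/(32√2 x)) ∫₀^q φ(-u²)φ(u⁴)(3ψ(-u²)⁴ - ψ(u²)⁴) du`. -/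
theorem stmt_9 (x : ℝ) (hx : 0 < x) (q : ℝ) (hq : q = Real.exp (-π*x/Real.sqrt 8)) :
    F22 x = 9*π^2/(32*Real.sqrt 2*x) *
      ∫ u in (0:ℝ)..q, phiR (-u^2) * phiR (u^4) * (3*psiR (-u^2)^4 - psiR (u^2)^4) := by
  have h0 : 0 < q := hq ▸ exp_pos _
  have h1 : q < 1 := by
    rw [hq, exp_lt_one_iff]
    exact div_neg_of_neg_of_pos (by nlinarith [mul_pos pi_pos hx]) (by positivity)
  have hI := integral_theta_product h0 h1
  rw [F22, ← hI.tsum_eq, (summable_lattice hx).tsum_prod, hI.summable.tsum_prod,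
    ← tsum_mul_left, ← tsum_mul_left]
  refine tsum_congr fun n => ?_
  have hB : (0 : ℝ) < 2 * n + 1 := by positivity
  have hin := tsum_neg_one_pow_mul_div_sq (mul_pos hx hB)
  have hqn : exp (-π * (x * (2 * n + 1)) / √8) = q ^ (2 * n + 1) := by
    rw [hq, ← Real.exp_nat_mul]
    congr 1
    push_cast
    ring
  rw [hqn] at hin
  have hl : ∀ k : ℕ, (-1 : ℝ) ^ (n * (n + 1) / 2 + k) * (2 * (k : ℝ) + 1) /
      (2 * (2 * (k : ℝ) + 1) ^ 2 + x ^ 2 * (2 * (n : ℝ) + 1) ^ 2) ^ 2 =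
      (-1 : ℝ) ^ (n * (n + 1) / 2) * ((-1 : ℝ) ^ k *
        ((2 * k + 1) / (2 * (2 * k + 1) ^ 2 + (x * (2 * n + 1)) ^ 2) ^ 2)) := fun k => by
    rw [pow_add, mul_pow x]; ring
  have hr : ∀ j : ℕ, 2 * ((-1 : ℝ) ^ (n * (n + 1) / 2 + j) *
      ((2 * (j : ℝ) + 1) / (2 * (n : ℝ) + 1) * q ^ ((2 * n + 1) * (2 * j + 1)))) =
      2 * (-1 : ℝ) ^ (n * (n + 1) / 2) / (2 * n + 1) *
        ((-1 : ℝ) ^ j * (2 * j + 1) * (q ^ (2 * n + 1)) ^ (2 * j + 1)) := fun j => by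
    rw [pow_add, pow_mul]; ring
  rw [tsum_congr hl, tsum_congr hr, tsum_mul_left, tsum_mul_left, hin]
  have h2 : 0 < √2 := by positivity
  field_simp
  ring
end

section
/- For every complex u with |u| < 1, the following eta-quotient identity holds: f(−u²)⁵·f(−u³)⁴·f(−u⁶) / f(−u)⁴ = f(−u³)⁹ / f(−u)³ + u · f(−u⁶)⁹ / f(−u²)³, i.e. ∏_{n≥1}(1−u^{2n})⁵(1−u^{3n})⁴(1−u^{6n})/(1−u^{n})⁴ = ∏_{n≥1}(1−u^{3n})⁹/(1−u^{n})³ + u·∏_{n≥1}(1−u^{6n})⁹/(1−u^{2n})³. -/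
open Real

/-- Ramanujan's function `f(-q) = ∏_{n≥1} (1 - qⁿ)`, for complex `|q| < 1`. -/
noncomputable def fC (q : ℂ) : ℂ := ∏' n : ℕ, (1 - q^(n+1))

open Filter Topology

/-- The `q`-Pochhammer symbol `(a; p)_∞ = ∏_{n ≥ 0} (1 - a pⁿ)`. -/
noncomputable def qPoch (a p : ℂ) : ℂ := ∏' n : ℕ, (1 - a * p ^ n)

/-- The bilateral theta series `∑ (-1)ⁿ s^(n² - n) xⁿ`. -/
noncomputable def thetaSeries (s x : ℂ) : ℂ := ∑' n : ℤ, (-1) ^ n * s ^ (n * (n - 1)) * x ^ n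

/-- The even part `∑ r^((2n)²) y^(2n)` of `∑ r^(n²) yⁿ`. -/
noncomputable def thetaEven (r y : ℂ) : ℂ := ∑' n : ℤ, r ^ ((2 * n) ^ 2) * y ^ (2 * n)

/-- The odd part `∑ r^((2n-1)²) y^(2n-1)` of `∑ r^(n²) yⁿ`. -/
noncomputable def thetaOdd (r y : ℂ) : ℂ := ∑' n : ℤ, r ^ ((2 * n - 1) ^ 2) * y ^ (2 * n - 1)

/-- Gaussian binomial coefficients, via the `q`-Pascal recursion. -/
def gaussBinom (p : ℂ) : ℕ → ℕ → ℂ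
  | _, 0 => 1
  | 0, _ + 1 => 0
  | M + 1, k + 1 => p ^ (k + 1) * gaussBinom p M (k + 1) + gaussBinom p M k

lemma gaussBinom_eq_zero (p : ℂ) {M k : ℕ} (h : M < k) : gaussBinom p M k = 0 := by
  induction M generalizing k with
  | zero => obtain ⟨k, rfl⟩ := Nat.exists_eq_succ_of_ne_zero h.ne'; rfl
  | succ M ih =>
    obtain ⟨k, rfl⟩ := Nat.exists_eq_succ_of_ne_zero (by omega : k ≠ 0)
    simp [gaussBinom, ih (by omega : M < k + 1), ih (by omega : M < k)]

/-- The `q`-binomial theorem. -/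
lemma prod_one_sub_eq_sum_gaussBinom (p z : ℂ) (M : ℕ) :
    ∏ k ∈ Finset.range M, (1 - z * p ^ k) =
      ∑ k ∈ Finset.range (M + 1), (-1) ^ k * p ^ (k.choose 2) * z ^ k * gaussBinom p M k := by
  induction M generalizing z with
  | zero => simp [gaussBinom]
  | succ M ih =>
    rw [Finset.prod_range_succ']
    have h1 : ∏ k ∈ Finset.range M, (1 - z * p ^ (k + 1)) =
        ∏ k ∈ Finset.range M, (1 - (z * p) * p ^ k) :=
      Finset.prod_congr rfl fun k _ => by ring
    have h2 := Finset.sum_range_succ' (fun k =>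
      (-1) ^ k * p ^ (k.choose 2) * (z * p) ^ k * gaussBinom p M k) (M + 1)
    rw [Finset.sum_range_succ, gaussBinom_eq_zero p (Nat.lt_succ_self M)] at h2
    rw [h1, ih, mul_sub, Finset.sum_range_succ' _ (M + 1)]
    simp only [pow_zero, mul_one, mul_zero, add_zero] at h2 ⊢
    conv_lhs => enter [1]; rw [h2]
    rw [Finset.sum_mul, add_sub_right_comm, ← Finset.sum_sub_distrib]
    have h0 : ∀ M, gaussBinom p M 0 = 1 := fun M => by cases M <;> rfl
    simp only [h0]
    congr 1
    refine Finset.sum_congr rfl fun k _ => ?_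
    have h3 : (k + 1).choose 2 = k + k.choose 2 := by
      rw [Nat.choose_succ_succ' k 1, Nat.choose_one_right]
    rw [gaussBinom, h3]
    ring

/-- The Gaussian binomial coefficient as a quotient of finite `q`-Pochhammer symbols. -/
lemma gaussBinom_mul_prod (p : ℂ) (i j : ℕ) :
    gaussBinom p (i + j) i * ((∏ k ∈ Finset.range i, (1 - p ^ (k + 1))) *
      ∏ k ∈ Finset.range j, (1 - p ^ (k + 1))) = ∏ k ∈ Finset.range (i + j), (1 - p ^ (k + 1)) := by
  induction h : i + j generalizing i j with
  | zero =>
    obtain ⟨rfl, rfl⟩ : i = 0 ∧ j = 0 := by omega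
    simp [gaussBinom]
  | succ M ih =>
    rcases i with _ | i
    · obtain rfl : j = M + 1 := by omega
      simp [gaussBinom]
    have hi := ih i j (by omega)
    rw [gaussBinom, Finset.prod_range_succ _ M]
    rcases j with _ | j
    · obtain rfl : i = M := by omega
      rw [gaussBinom_eq_zero p (Nat.lt_succ_self _), Finset.prod_range_succ _ i]
      linear_combination (1 - p ^ (i + 1)) * hi
    · have hj := ih (i + 1) j (by omega)
      obtain rfl : M = i + 1 + j := by omega
      rw [Finset.prod_range_succ _ i] at hj ⊢
      rw [Finset.prod_range_succ _ j] at hi ⊢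
      linear_combination (1 - p ^ (i + 1)) * hi + p ^ (i + 1) * (1 - p ^ (j + 1)) * hj

lemma summable_zpow_sq_mul_zpow {r z : ℂ} (hr0 : r ≠ 0) (hr : ‖r‖ < 1) (hz : z ≠ 0) :
    Summable fun n : ℤ => ‖r ^ (n ^ 2) * z ^ n‖ := by
  have key : ∀ z : ℂ, z ≠ 0 → Summable fun n : ℕ => r ^ (n ^ 2) * z ^ n := by
    intro z hz
    refine summable_of_ratio_test_tendsto_lt_one (l := 0) one_pos
      (.of_forall fun n => by positivity) ?_
    have h1 : Tendsto (fun n : ℕ => ‖r‖ ^ n) atTop (𝓝 0) :=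
      tendsto_pow_atTop_nhds_zero_of_lt_one (norm_nonneg _) hr
    have h2 : Tendsto (fun n : ℕ => ‖r‖ ^ n * ‖r‖ ^ n * ‖r‖ * ‖z‖) atTop (𝓝 0) := by
      simpa using ((h1.mul h1).mul_const ‖r‖).mul_const ‖z‖
    refine h2.congr fun n => ?_
    rw [← norm_div, ← norm_pow, ← norm_mul, ← norm_mul, ← norm_mul]
    congr 1
    field_simp
    ring
  rw [summable_norm_iff]
  refine Summable.of_nat_of_neg ?_ ?_
  · simpa [← zpow_natCast] using key z hz
  · simpa [← zpow_natCast] using key z⁻¹ (inv_ne_zero hz)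

lemma summable_thetaSeries {s x : ℂ} (hs0 : s ≠ 0) (hs : ‖s‖ < 1) (hx : x ≠ 0) :
    Summable fun n : ℤ => ‖(-1) ^ n * s ^ (n * (n - 1)) * x ^ n‖ := by
  refine (summable_zpow_sq_mul_zpow hs0 hs (div_ne_zero hx hs0)).congr fun n => ?_
  rw [mul_assoc, norm_mul ((-1) ^ n), norm_zpow, norm_neg, norm_one, one_zpow, one_mul]
  congr 1
  rw [show n * (n - 1) = n ^ 2 - n by ring, zpow_sub₀ hs0, div_zpow]
  ring

lemma multipliable_qPoch (a : ℂ) {p : ℂ} (hp : ‖p‖ < 1) :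
    Multipliable fun n : ℕ => 1 - a * p ^ n := by
  simp only [sub_eq_add_neg]
  apply multipliable_one_add_of_summable
  simpa using (summable_geometric_of_lt_one (norm_nonneg _) hp).mul_left ‖a‖

lemma tendsto_qPoch (a : ℂ) {p : ℂ} (hp : ‖p‖ < 1) :
    Tendsto (fun N => ∏ n ∈ Finset.range N, (1 - a * p ^ n)) atTop (𝓝 (qPoch a p)) :=
  (multipliable_qPoch a hp).hasProd.tendsto_prod_nat

lemma qPoch_ne_zero {a p : ℂ} (ha : ‖a‖ < 1) (hp : ‖p‖ < 1) : qPoch a p ≠ 0 := by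
  simp only [qPoch, sub_eq_add_neg]
  refine tprod_one_add_ne_zero_of_summable (fun n h => ?_) ?_
  · have h1 : a * p ^ n = 1 := by linear_combination -h
    have h2 : ‖a * p ^ n‖ < 1 := by
      rw [norm_mul, norm_pow]
      exact mul_lt_one_of_nonneg_of_lt_one_left (norm_nonneg _) ha
        (pow_le_one₀ (norm_nonneg _) hp.le)
    rw [h1, norm_one] at h2
    exact lt_irrefl _ h2
  · simpa using (summable_geometric_of_lt_one (norm_nonneg _) hp).mul_left ‖a‖

/-- Splitting a `q`-Pochhammer symbol into residue classes of the exponent. -/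
lemma qPoch_eq_prod (a : ℂ) {p : ℂ} (hp : ‖p‖ < 1) {m : ℕ} (hm : m ≠ 0) :
    qPoch a p = ∏ j ∈ Finset.range m, qPoch (a * p ^ j) (p ^ m) := by
  have hpm : ‖p ^ m‖ < 1 := by
    rw [norm_pow]; exact pow_lt_one₀ (norm_nonneg _) hp hm
  have h1 : Tendsto (fun N : ℕ => ∏ n ∈ Finset.range (N * m), (1 - a * p ^ n)) atTop
      (𝓝 (qPoch a p)) :=
    (tendsto_qPoch a hp).comp (tendsto_id.atTop_mul_const' (Nat.pos_of_ne_zero hm))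
  refine tendsto_nhds_unique h1
    ((tendsto_finsetProd _ fun j _ => tendsto_qPoch (a * p ^ j) hpm).congr fun N => ?_)
  rw [Finset.prod_comm]
  induction N with
  | zero => simp
  | succ N ih =>
    rw [Finset.prod_range_succ, ih, Nat.succ_mul, Finset.prod_range_add]
    congr 1
    refine Finset.prod_congr rfl fun j _ => ?_
    ring

/-- The finite form of the Jacobi triple product identity. -/
lemma finite_jacobi_triple_product {s x : ℂ} (hs0 : s ≠ 0) (hx : x ≠ 0) (N : ℕ) :
    (∏ k ∈ Finset.range N, (1 - x * (s ^ 2) ^ k)) *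
      ∏ k ∈ Finset.range N, (1 - s ^ 2 / x * (s ^ 2) ^ k) =
    ∑ k ∈ Finset.range (2 * N + 1), (-1) ^ ((k : ℤ) - N) * s ^ (((k : ℤ) - N) * ((k : ℤ) - N - 1)) *
      x ^ ((k : ℤ) - N) * gaussBinom (s ^ 2) (2 * N) k := by
  have h := prod_one_sub_eq_sum_gaussBinom (s ^ 2) (x / (s ^ 2) ^ N) (2 * N)
  have hlow : ∏ k ∈ Finset.range N, (1 - x / (s ^ 2) ^ N * (s ^ 2) ^ k) =
      (-1) ^ N * x ^ N * (s ^ (N * (N + 1)))⁻¹ *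
        ∏ k ∈ Finset.range N, (1 - s ^ 2 / x * (s ^ 2) ^ k) := by
    rw [← Finset.prod_range_reflect]
    have h1 : (-1) ^ N * x ^ N * (s ^ (N * (N + 1)))⁻¹ =
        ∏ k ∈ Finset.range N, (-x * ((s ^ 2) ^ (k + 1))⁻¹) := by
      clear h
      induction N with
      | zero => simp
      | succ N ih =>
        rw [Finset.prod_range_succ, ← ih]
        field_simp
        ring
    rw [h1, ← Finset.prod_mul_distrib]
    refine Finset.prod_congr rfl fun k hk => ?_
    obtain ⟨j, rfl⟩ : ∃ j, N = k + 1 + j := ⟨N - (k + 1), by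
      have := Finset.mem_range.mp hk; omega⟩
    rw [show k + 1 + j - 1 - k = j by omega]
    field_simp
    ring
  have hhigh : ∏ k ∈ Finset.range N, (1 - x / (s ^ 2) ^ N * (s ^ 2) ^ (N + k)) =
      ∏ k ∈ Finset.range N, (1 - x * (s ^ 2) ^ k) := by
    refine Finset.prod_congr rfl fun k _ => ?_
    field_simp
    ring
  rw [show ∏ k ∈ Finset.range (2 * N), (1 - x / (s ^ 2) ^ N * (s ^ 2) ^ k) = _ by
    rw [two_mul, Finset.prod_range_add], hlow, hhigh] at h
  have hc : (-1) ^ N * x ^ N * (s ^ (N * (N + 1)))⁻¹ ≠ 0 := by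
    simp [hx, hs0]
  refine mul_left_cancel₀ hc ?_
  rw [Finset.mul_sum]
  refine Eq.trans ?_ (h.trans (Finset.sum_congr rfl fun k _ => ?_))
  · ring
  · have e1 : (-1 : ℂ) ^ k = (-1) ^ N * (-1) ^ ((k : ℤ) - N) := by
      rw [← zpow_natCast, ← zpow_natCast, ← zpow_add₀ (by norm_num)]
      congr 1; ring
    have e2 : x ^ k = x ^ N * x ^ ((k : ℤ) - N) := by
      rw [← zpow_natCast, ← zpow_natCast, ← zpow_add₀ hx]
      congr 1; ring
    have e3 : (s ^ 2) ^ k.choose 2 * ((s ^ 2) ^ N)⁻¹ ^ k =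
        (s ^ (N * (N + 1)))⁻¹ * s ^ (((k : ℤ) - N) * ((k : ℤ) - N - 1)) := by
      have e4 : ((2 * k.choose 2 : ℕ) : ℤ) = k * (k - 1) := by
        rw [Nat.choose_two_right, Nat.mul_div_cancel' (Nat.even_mul_pred_self k).two_dvd]
        cases k <;> simp
      rw [← pow_mul, ← pow_mul, inv_pow, ← pow_mul]
      simp only [← zpow_natCast, ← zpow_neg]
      rw [← zpow_add₀ hs0, ← zpow_add₀ hs0, e4]
      congr 1
      push_cast
      ring
    rw [div_eq_mul_inv, mul_pow, e1, e2]
    linear_combination ((-1) ^ N * (-1) ^ ((k : ℤ) - N)) * (x ^ N * x ^ ((k : ℤ) - N)) *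
      gaussBinom (s ^ 2) (2 * N) k * e3

/-- The **Jacobi triple product** identity. -/
theorem jacobi_triple_product {s x : ℂ} (hs0 : s ≠ 0) (hs : ‖s‖ < 1) (hx : x ≠ 0) :
    qPoch (s ^ 2) (s ^ 2) * (qPoch x (s ^ 2) * qPoch (s ^ 2 / x) (s ^ 2)) = thetaSeries s x := by
  have hp : ‖s ^ 2‖ < 1 := by
    rw [norm_pow]; exact pow_lt_one₀ (norm_nonneg _) hs two_ne_zero
  set Q : ℕ → ℂ := fun N => ∏ k ∈ Finset.range N, (1 - (s ^ 2) ^ (k + 1)) with hQ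
  set L := qPoch (s ^ 2) (s ^ 2) with hL
  have hL0 : L ≠ 0 := qPoch_ne_zero hp hp
  have hQL : Tendsto Q atTop (𝓝 L) :=
    (tendsto_qPoch (s ^ 2) hp).congr fun N => Finset.prod_congr rfl fun k _ => by ring
  have hQ0 : ∀ N, Q N ≠ 0 := fun N => by
    refine Finset.prod_ne_zero_iff.mpr fun k _ h => ?_
    have h1 : ‖(s ^ 2) ^ (k + 1)‖ < 1 := by
      rw [norm_pow]; exact pow_lt_one₀ (norm_nonneg _) hp k.succ_ne_zero
    rw [← sub_eq_zero.mp h, norm_one] at h1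
    exact lt_irrefl _ h1
  have hG : ∀ i j, gaussBinom (s ^ 2) (i + j) i = Q (i + j) * ((Q i)⁻¹ * (Q j)⁻¹) := fun i j => by
    have h := gaussBinom_mul_prod (s ^ 2) i j
    rw [← mul_inv, ← div_eq_mul_inv, eq_div_iff (mul_ne_zero (hQ0 i) (hQ0 j))]
    exact h
  obtain ⟨C, hC⟩ : ∃ C, ∀ N, ‖Q N‖ ≤ C := by
    obtain ⟨C, hC⟩ := (Metric.isBounded_range_of_tendsto Q hQL).exists_norm_le
    exact ⟨C, fun N => hC _ ⟨N, rfl⟩⟩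
  obtain ⟨D, hD⟩ : ∃ D, ∀ N, ‖(Q N)⁻¹‖ ≤ D := by
    obtain ⟨D, hD⟩ := (Metric.isBounded_range_of_tendsto _ (hQL.inv₀ hL0)).exists_norm_le
    exact ⟨D, fun N => hD _ ⟨N, rfl⟩⟩
  have hC0 : 0 ≤ C := (norm_nonneg _).trans (hC 0)
  have hD0 : 0 ≤ D := (norm_nonneg _).trans (hD 0)
  set t : ℤ → ℂ := fun n => (-1) ^ n * s ^ (n * (n - 1)) * x ^ n with ht
  set g : ℕ → ℤ → ℂ := fun N n =>
    if 0 ≤ n + N then gaussBinom (s ^ 2) (2 * N) (n + N).toNat else 0 with hg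
  have hfin : ∀ N : ℕ, ∑' n, t n * g N n = (∏ k ∈ Finset.range N, (1 - x * (s ^ 2) ^ k)) *
      ∏ k ∈ Finset.range N, (1 - s ^ 2 / x * (s ^ 2) ^ k) := fun N => by
    rw [finite_jacobi_triple_product hs0 hx]
    have hinj : Function.Injective fun k : ℕ => (k : ℤ) - N := fun a b h => by
      simpa using h
    rw [← hinj.tsum_eq, tsum_eq_sum (s := Finset.range (2 * N + 1))]
    · refine Finset.sum_congr rfl fun k _ => ?_
      simp [ht, hg]
    · intro k hk
      simp only [Finset.mem_range, not_lt] at hk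
      simp [hg, gaussBinom_eq_zero _ (show 2 * N < k by omega)]
    · intro n hn
      rw [Function.mem_support] at hn
      by_cases h : 0 ≤ n + N
      · exact ⟨(n + N).toNat, by simp [h]⟩
      · exact absurd (by simp [hg, h]) hn
  have hlim : Tendsto (fun N : ℕ => ∑' n, t n * g N n) atTop (𝓝 (∑' n, t n * L⁻¹)) := by
    refine tendsto_tsum_of_dominated_convergence (bound := fun n => ‖t n‖ * (C * (D * D)))
      ((summable_thetaSeries hs0 hs hx).mul_right _) (fun n => ?_) (.of_forall fun N n => ?_)
    · refine Tendsto.const_mul _ ?_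
      have h1 : Tendsto (fun N : ℕ => (n + N).toNat) atTop atTop :=
        tendsto_atTop.mpr fun b => (eventually_ge_atTop (b + n.natAbs)).mono fun N h => by omega
      have h2 : Tendsto (fun N : ℕ => (N - n).toNat) atTop atTop :=
        tendsto_atTop.mpr fun b => (eventually_ge_atTop (b + n.natAbs)).mono fun N h => by omega
      have h3 : Tendsto (fun N : ℕ => 2 * N) atTop atTop :=
        tendsto_id.const_mul_atTop' two_pos
      have h4 := (hQL.comp h3).mul (((hQL.comp h1).inv₀ hL0).mul ((hQL.comp h2).inv₀ hL0))
      rw [mul_inv_cancel_left₀ hL0] at h4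
      refine h4.congr' ((eventually_ge_atTop n.natAbs).mono fun N hN => ?_)
      have h5 := hG (n + N).toNat (N - n).toNat
      rw [show (n + N).toNat + (N - n).toNat = 2 * N by omega] at h5
      simp only [hg, if_pos (show 0 ≤ n + (N : ℤ) by omega), h5, Function.comp]
    · rw [norm_mul]
      refine mul_le_mul_of_nonneg_left ?_ (norm_nonneg _)
      have hpos : 0 ≤ C * (D * D) := by positivity
      by_cases h : 0 ≤ n + N
      · simp only [hg, if_pos h]
        by_cases h' : n ≤ N
        · have h5 := hG (n + N).toNat (N - n).toNat
          rw [show (n + N).toNat + (N - n).toNat = 2 * N by omega] at h5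
          rw [h5, norm_mul, norm_mul]
          gcongr
          exacts [hC _, hD _, hD _]
        · rw [gaussBinom_eq_zero _ (by omega), norm_zero]
          exact hpos
      · simp only [hg, if_neg h, norm_zero]
        exact hpos
  simp only [hfin] at hlim
  have := tendsto_nhds_unique ((tendsto_qPoch x hp).mul (tendsto_qPoch (s ^ 2 / x) hp)) hlim
  rw [this, tsum_mul_right, mul_comm, inv_mul_cancel_right₀ hL0]
  rfl

/-- Summing over `ℤ × ℤ` according to the parity of the sum of the coordinates. -/
lemma hasSum_int_prod_of_parity {F : ℤ × ℤ → ℂ} {A B : ℂ}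
    (hA : HasSum (fun a : ℤ × ℤ => F (a.1 + a.2, a.1 - a.2)) A)
    (hB : HasSum (fun a : ℤ × ℤ => F (a.1 + a.2, a.1 - a.2 + 1)) B) : HasSum F (A + B) := by
  set e : ℤ × ℤ → ℤ × ℤ := fun a => (a.1 + a.2, a.1 - a.2) with he
  set o : ℤ × ℤ → ℤ × ℤ := fun a => (a.1 + a.2, a.1 - a.2 + 1) with ho
  have hei : Function.Injective e := fun a b h => by
    simp only [he, Prod.mk.injEq] at h
    ext <;> omega
  have hoi : Function.Injective o := fun a b h => by
    simp only [ho, Prod.mk.injEq] at h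
    ext <;> omega
  have hcompl : IsCompl (Set.range e) (Set.range o) := by
    refine ⟨Set.disjoint_left.mpr ?_, codisjoint_iff.mpr (Set.eq_univ_of_forall ?_)⟩
    · rintro _ ⟨a, rfl⟩ ⟨b, h⟩
      simp only [he, ho, Prod.mk.injEq] at h
      omega
    · rintro ⟨m, n⟩
      rcases Int.even_or_odd' (m + n) with ⟨k, hk | hk⟩
      · exact Or.inl ⟨(k, m - k), Prod.ext (by simp [he]) (by simp only [he]; omega)⟩
      · exact Or.inr ⟨(k, m - k), Prod.ext (by simp [ho]) (by simp only [ho]; omega)⟩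
  exact (hei.hasSum_range_iff.mpr hA).add_isCompl hcompl (hoi.hasSum_range_iff.mpr hB)

lemma thetaSeries_term_mul_term {r x y : ℂ} (hr0 : r ≠ 0) (hx : x ≠ 0) (hy : y ≠ 0) (m n : ℤ) :
    (-1) ^ m * (r ^ 2) ^ (m * (m - 1)) * (x * y) ^ m *
      ((-1) ^ n * (r ^ 2) ^ (n * (n - 1)) * (x / y) ^ n) =
    (-1) ^ (m + n) *
      (r ^ (2 * (m * (m - 1) + n * (n - 1))) * x ^ (m + n) * y ^ (m - n)) := by
  rw [zpow_add₀ (by norm_num : (-1 : ℂ) ≠ 0), zpow_add₀ hx, zpow_sub₀ hy, mul_zpow, div_zpow,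
    mul_add, zpow_add₀ hr0, zpow_mul r 2 (m * (m - 1)), zpow_mul r 2 (n * (n - 1)), zpow_ofNat]
  ring

lemma hasSum_mul_of_summable_norm {f g : ℤ → ℂ} (hf : Summable fun n => ‖f n‖)
    (hg : Summable fun n => ‖g n‖) :
    HasSum (fun x : ℤ × ℤ => f x.1 * g x.2) ((∑' n, f n) * ∑' n, g n) :=
  hf.of_norm.hasSum.mul hg.of_norm.hasSum (summable_mul_of_summable_norm hf hg)

/-- The product `θ(xy) θ(x/y)` as a `2 × 2` determinant in `x` and `y`. -/
lemma thetaSeries_mul_thetaSeries {r x y : ℂ} (hr0 : r ≠ 0) (hr : ‖r‖ < 1) (hx : x ≠ 0)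
    (hy : y ≠ 0) :
    thetaSeries (r ^ 2) (x * y) * thetaSeries (r ^ 2) (x / y) =
      x / r * (thetaOdd r x * thetaEven r y - thetaEven r x * thetaOdd r y) := by
  have hs : ‖r ^ 2‖ < 1 := by
    rw [norm_pow]; exact pow_lt_one₀ (norm_nonneg _) hr two_ne_zero
  have hs0 : r ^ 2 ≠ 0 := pow_ne_zero _ hr0
  have hsum1 := summable_thetaSeries hs0 hs (mul_ne_zero hx hy)
  have hsum2 := summable_thetaSeries hs0 hs (div_ne_zero hx hy)
  have heven : ∀ z : ℂ, z ≠ 0 → Summable fun n : ℤ => ‖r ^ ((2 * n) ^ 2) * z ^ (2 * n)‖ :=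
    fun z hz => (summable_zpow_sq_mul_zpow hr0 hr hz).comp_injective
      (i := fun n : ℤ => 2 * n) fun a b h => by simpa using h
  have hodd : ∀ z : ℂ, z ≠ 0 →
      Summable fun n : ℤ => ‖r ^ ((2 * n - 1) ^ 2) * z ^ (2 * n - 1)‖ :=
    fun z hz => (summable_zpow_sq_mul_zpow hr0 hr hz).comp_injective
      (i := fun n : ℤ => 2 * n - 1) fun a b h => by simpa using h
  have hprod := hasSum_mul_of_summable_norm hsum1 hsum2
  have h1 := (hasSum_mul_of_summable_norm (hodd x hx) (heven y hy)).mul_left (x / r)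
  have h2 := (hasSum_mul_of_summable_norm (heven x hx) (hodd y hy)).mul_left (-(x / r))
  rw [thetaSeries, thetaSeries, mul_sub, sub_eq_add_neg, ← neg_mul]
  refine hprod.unique (hasSum_int_prod_of_parity (h1.congr_fun ?_) (h2.congr_fun ?_))
  · rintro ⟨a, b⟩
    dsimp only
    rw [thetaSeries_term_mul_term hr0 hx hy,
      show a + b + (a - b) = 2 * a by ring, show a + b - (a - b) = 2 * b by ring,
      (even_two_mul a).neg_one_zpow, zpow_sub₀ hx, zpow_one,
      show 2 * ((a + b) * (a + b - 1) + (a - b) * (a - b - 1)) =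
        (2 * a - 1) ^ 2 + (2 * b) ^ 2 - 1 by ring, zpow_sub₀ hr0, zpow_add₀ hr0, zpow_one]
    field_simp
  · rintro ⟨a, b⟩
    dsimp only
    rw [thetaSeries_term_mul_term hr0 hx hy, show a + b + (a - b + 1) = 2 * a + 1 by ring,
      show a + b - (a - b + 1) = 2 * b - 1 by ring,
      (odd_two_mul_add_one a).neg_one_zpow, zpow_add₀ hx, zpow_one,
      show 2 * ((a + b) * (a + b - 1) + (a - b + 1) * (a - b + 1 - 1)) =
        (2 * a) ^ 2 + (2 * b - 1) ^ 2 - 1 by ring, zpow_sub₀ hr0, zpow_add₀ hr0, zpow_one]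
    field_simp

/-- A case of the Weierstrass three-term relation, for the theta products of base `q ^ 12`. -/
lemma theta_products_relation {q : ℂ} (hq0 : q ≠ 0) (hq : ‖q‖ < 1) :
    let P : ℕ → ℂ := fun k => qPoch (q ^ k) (q ^ 12)
    (P 4 * P 8) ^ 2 * (P 1 * P 11) * (P 5 * P 7) + q * (P 2 * P 10) ^ 2 * (P 1 * P 11) * (P 5 * P 7)
      = (P 3 * P 9) ^ 2 * (P 2 * P 10) * (P 6 * P 6) := by
  intro P
  have hr0 : q ^ 3 ≠ 0 := pow_ne_zero _ hq0
  have hr : ‖q ^ 3‖ < 1 := by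
    rw [norm_pow]; exact pow_lt_one₀ (norm_nonneg _) hq three_ne_zero
  have hp : ‖q ^ 12‖ < 1 := by
    rw [norm_pow]; exact pow_lt_one₀ (norm_nonneg _) hq (by norm_num)
  have hs : ‖(q ^ 3) ^ 2‖ < 1 := by
    rw [norm_pow]; exact pow_lt_one₀ (norm_nonneg _) hr two_ne_zero
  set L := qPoch (q ^ 12) (q ^ 12) with hL
  have hL0 : L ≠ 0 := qPoch_ne_zero hp hp
  have hJ : ∀ k l : ℕ, k + l = 12 → thetaSeries ((q ^ 3) ^ 2) (q ^ k) = L * (P k * P l) := by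
    intro k l hkl
    rw [← jacobi_triple_product (pow_ne_zero 2 hr0) hs (pow_ne_zero k hq0)]
    have h12 : ((q ^ 3) ^ 2) ^ 2 = q ^ 12 := by ring
    have hl : q ^ 12 / q ^ k = q ^ l := by
      rw [← hkl, pow_add, mul_div_cancel_left₀ _ (pow_ne_zero k hq0)]
    rw [h12, hl]
  have hW : ∀ i j k l : ℕ, k = i + j → l + j = i →
      thetaSeries ((q ^ 3) ^ 2) (q ^ k) * thetaSeries ((q ^ 3) ^ 2) (q ^ l) =
      q ^ i / q ^ 3 * (thetaOdd (q ^ 3) (q ^ i) * thetaEven (q ^ 3) (q ^ j) -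
        thetaEven (q ^ 3) (q ^ i) * thetaOdd (q ^ 3) (q ^ j)) := by
    rintro i j k l rfl rfl
    rw [← thetaSeries_mul_thetaSeries hr0 hr (pow_ne_zero _ hq0) (pow_ne_zero _ hq0), ← pow_add,
      pow_add q l j, mul_div_cancel_right₀ _ (pow_ne_zero j hq0)]
  have w40 := hW 4 0 4 4 rfl rfl
  have w32 := hW 3 2 5 1 rfl rfl
  have w42 := hW 4 2 6 2 rfl rfl
  have w30 := hW 3 0 3 3 rfl rfl
  have w43 := hW 4 3 7 1 rfl rfl
  have w20 := hW 2 0 2 2 rfl rfl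
  rw [hJ 4 8 rfl] at w40
  rw [hJ 5 7 rfl, hJ 1 11 rfl] at w32
  rw [hJ 6 6 rfl, hJ 2 10 rfl] at w42
  rw [hJ 3 9 rfl] at w30
  rw [hJ 7 5 rfl, hJ 1 11 rfl] at w43
  rw [hJ 2 10 rfl] at w20
  refine mul_left_cancel₀ (pow_ne_zero 4 hL0) ?_
  calc _ = (L * (P 4 * P 8) * (L * (P 4 * P 8))) * (L * (P 5 * P 7) * (L * (P 1 * P 11))) +
        q * ((L * (P 7 * P 5) * (L * (P 1 * P 11))) * (L * (P 2 * P 10) * (L * (P 2 * P 10)))) := by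
          ring
    _ = (L * (P 6 * P 6) * (L * (P 2 * P 10))) * (L * (P 3 * P 9) * (L * (P 3 * P 9))) := by
          rw [w40, w32, w42, w30, w43, w20]
          field_simp
          ring
    _ = _ := by ring

lemma fC_eq_qPoch (q : ℂ) : fC q = qPoch q q := tprod_congr fun n => by ring

lemma fC_pow_eq_prod {q : ℂ} (hq : ‖q‖ < 1) {k m : ℕ} (hk : k ≠ 0) (hm : m ≠ 0) :
    fC (q ^ k) = ∏ j ∈ Finset.range m, qPoch (q ^ (k * (j + 1))) (q ^ (k * m)) := by
  have hqk : ‖q ^ k‖ < 1 := by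
    rw [norm_pow]; exact pow_lt_one₀ (norm_nonneg _) hq hk
  rw [fC_eq_qPoch, qPoch_eq_prod _ hqk hm]
  refine Finset.prod_congr rfl fun j _ => ?_
  congr 1 <;> ring

lemma fC_ne_zero {q : ℂ} (hq : ‖q‖ < 1) : fC q ≠ 0 := by
  rw [fC_eq_qPoch]
  exact qPoch_ne_zero hq hq

/-- The 2-dissection of `f(-q³)³ / f(-q)`. -/
lemma fC_cubed_div_dissection {q : ℂ} (hq0 : q ≠ 0) (hq : ‖q‖ < 1) :
    fC (q ^ 3) ^ 3 / fC q =
      fC (q ^ 4) ^ 3 * fC (q ^ 6) ^ 2 / (fC (q ^ 2) ^ 2 * fC (q ^ 12)) +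
        q * (fC (q ^ 12) ^ 3 / fC (q ^ 4)) := by
  have hp : ∀ k : ℕ, k ≠ 0 → ‖q ^ k‖ < 1 := fun k hk => by
    rw [norm_pow]; exact pow_lt_one₀ (norm_nonneg _) hq hk
  have hrel := theta_products_relation hq0 hq
  have hP : ∀ k : ℕ, k ≠ 0 → qPoch (q ^ k) (q ^ 12) ≠ 0 := fun k hk =>
    qPoch_ne_zero (hp k hk) (hp 12 (by norm_num))
  have e1 := fC_pow_eq_prod hq one_ne_zero (show 12 ≠ 0 by norm_num)
  have e2 := fC_pow_eq_prod hq two_ne_zero (show 6 ≠ 0 by norm_num)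
  have e3 := fC_pow_eq_prod hq three_ne_zero (show 4 ≠ 0 by norm_num)
  have e4 := fC_pow_eq_prod hq four_ne_zero (show 3 ≠ 0 by norm_num)
  have e6 := fC_pow_eq_prod hq (show 6 ≠ 0 by norm_num) (show 2 ≠ 0 by norm_num)
  have e12 := fC_pow_eq_prod hq (show 12 ≠ 0 by norm_num) (show 1 ≠ 0 by norm_num)
  simp only [Finset.prod_range_succ, Finset.prod_range_zero, one_mul, pow_one] at e1
  simp only [Finset.prod_range_succ, Finset.prod_range_zero, one_mul] at e2 e3 e4 e6 e12
  norm_num only [pow_one] at e1 e2 e3 e4 e6 e12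
  have hP1 := hP 1 (by norm_num)
  have hP2 := hP 2 (by norm_num)
  have hP3 := hP 3 (by norm_num)
  have hP4 := hP 4 (by norm_num)
  have hP5 := hP 5 (by norm_num)
  have hP6 := hP 6 (by norm_num)
  have hP7 := hP 7 (by norm_num)
  have hP8 := hP 8 (by norm_num)
  have hP9 := hP 9 (by norm_num)
  have hP10 := hP 10 (by norm_num)
  have hP11 := hP 11 (by norm_num)
  have hP12 := hP 12 (by norm_num)
  rw [e1, e2, e3, e4, e6, e12]
  simp only [pow_one] at hrel hP1 ⊢
  generalize qPoch q (q ^ 12) = P1 at *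
  generalize qPoch (q ^ 2) (q ^ 12) = P2 at *
  generalize qPoch (q ^ 3) (q ^ 12) = P3 at *
  generalize qPoch (q ^ 4) (q ^ 12) = P4 at *
  generalize qPoch (q ^ 5) (q ^ 12) = P5 at *
  generalize qPoch (q ^ 6) (q ^ 12) = P6 at *
  generalize qPoch (q ^ 7) (q ^ 12) = P7 at *
  generalize qPoch (q ^ 8) (q ^ 12) = P8 at *
  generalize qPoch (q ^ 9) (q ^ 12) = P9 at *
  generalize qPoch (q ^ 10) (q ^ 12) = P10 at *
  generalize qPoch (q ^ 11) (q ^ 12) = P11 at *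
  generalize qPoch (q ^ 12) (q ^ 12) = P12 at *
  field_simp
  linear_combination -hrel

/-- `f(q) f(-q) f(-q⁴) = f(-q²)³`. -/
lemma fC_neg_mul {q : ℂ} (hq : ‖q‖ < 1) : fC (-q) * fC q * fC (q ^ 4) = fC (q ^ 2) ^ 3 := by
  have hq2 : ‖q ^ 2‖ < 1 := by
    rw [norm_pow]; exact pow_lt_one₀ (norm_nonneg _) hq two_ne_zero
  have h1 := fC_pow_eq_prod hq one_ne_zero two_ne_zero
  have h2 := fC_pow_eq_prod (q := -q) (by rwa [norm_neg]) one_ne_zero two_ne_zero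
  have h3 := fC_pow_eq_prod hq two_ne_zero two_ne_zero
  have h4 : qPoch q (q ^ 2) * qPoch (-q) (q ^ 2) = qPoch (q ^ 2) (q ^ 4) := by
    rw [qPoch, qPoch, ← (multipliable_qPoch q hq2).tprod_mul (multipliable_qPoch (-q) hq2)]
    exact tprod_congr fun n => by ring
  simp only [Finset.prod_range_succ, Finset.prod_range_zero, one_mul, zero_add, mul_one, pow_one,
    one_add_one_eq_two, neg_sq] at h1 h2 h3
  norm_num only [← fC_eq_qPoch] at h1 h2 h3
  rw [h1, h2]
  linear_combination fC (q ^ 2) ^ 2 * fC (q ^ 4) * h4 - fC (q ^ 2) ^ 2 * h3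

/-- The eta-quotient identity
`f(-u²)⁵f(-u³)⁴f(-u⁶)/f(-u)⁴ = f(-u³)⁹/f(-u)³ + u·f(-u⁶)⁹/f(-u²)³` for `|u| < 1`. -/
theorem stmt_10 (u : ℂ) (hu : ‖u‖ < 1) :
    fC (u^2)^5 * fC (u^3)^4 * fC (u^6) / fC u ^ 4 =
      fC (u^3)^9 / fC u ^ 3 + u * fC (u^6)^9 / fC (u^2)^3 := by
  rcases eq_or_ne u 0 with rfl | hu0
  · simp [fC]
  obtain ⟨q, rfl⟩ : ∃ q : ℂ, u = q ^ 2 := ⟨_, (Complex.cpow_nat_inv_pow u two_ne_zero).symm⟩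
  have hq0 : q ≠ 0 := fun h => hu0 (by simp [h])
  have hq : ‖q‖ < 1 := by
    rw [norm_pow] at hu
    exact (pow_lt_one_iff_of_nonneg (norm_nonneg _) two_ne_zero).mp hu
  have hE : ∀ k : ℕ, k ≠ 0 → fC (q ^ k) ≠ 0 := fun k hk =>
    fC_ne_zero (by rw [norm_pow]; exact pow_lt_one₀ (norm_nonneg _) hq hk)
  have hq3 : ‖q ^ 3‖ < 1 := by
    rw [norm_pow]; exact pow_lt_one₀ (norm_nonneg _) hq three_ne_zero
  have hpos := fC_cubed_div_dissection hq0 hq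
  have hneg := fC_cubed_div_dissection (neg_ne_zero.mpr hq0) (by rwa [norm_neg])
  have hn1 := fC_neg_mul hq
  have hn3 := fC_neg_mul hq3
  have hm1 : fC (-q) ≠ 0 := fC_ne_zero (by rwa [norm_neg])
  simp only [← pow_mul, Even.neg_pow (show Even 2 by decide), Even.neg_pow (show Even 4 by decide),
    Even.neg_pow (show Even 6 by decide), Even.neg_pow (show Even 12 by decide),
    Odd.neg_pow (show Odd 3 by decide)] at hneg hn3 ⊢
  norm_num only at hn3 ⊢
  have h1 := fC_ne_zero hq
  have h2 := hE 2 (by norm_num)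
  have h3 := hE 3 (by norm_num)
  have h4 := hE 4 (by norm_num)
  have h6 := hE 6 (by norm_num)
  have h12 := hE 12 (by norm_num)
  have key : fC (q ^ 3) ^ 3 / fC q * (fC (-q ^ 3) ^ 3 / fC (-q)) =
      fC (q ^ 6) ^ 9 * fC (q ^ 4) / (fC (q ^ 12) ^ 3 * fC (q ^ 2) ^ 3) := by
    rw [← hn1, show fC (q ^ 6) ^ 9 = (fC (q ^ 6) ^ 3) ^ 3 by ring, ← hn3]
    field_simp
  rw [hpos, hneg] at key
  field_simp at key ⊢
  linear_combination key
end
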